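/- arXiv:2106.07391 — 5 statements merged into one kernel-verified Lean document; each statement's English description precedes it below -/
import Mathlib

section
/- Let H be a Hamiltonian on [a,b), let z lie in the open upper half-plane and let t ∈ (a,b) be such that h2 does not vanish a.e. on (a,t). Define ∇(t,z) = ∫_a^t W(s,z) H(s) W(s,z)* ds, a(t,z) = the (2,2)-entry of ∇(t,z), and b(t,z) = the (1,2)-entry of ∇(t,z). Then a(t,z) > 0, and the image of the closed upper half-plane (on the Riemann sphere) under the fractional linear transformation ζ ↦ (w11(t,z)ζ + w12(t,z))/(w21(t,z)ζ + w22(t,z)) is the closed disc with centre b(t,z)/a(t,z) + i/(2·(Im z)·a(t,z)) and radius 1/(2·(Im z)·a(t,z)). -/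
open MeasureTheory Filter Topology Matrix Set
open scoped ENNReal

noncomputable section

/-- The symplectic matrix `J = [[0,-1],[1,0]]` (real version). -/
def Jmat : Matrix (Fin 2) (Fin 2) ℝ := !![0, -1; 1, 0]

/-- The symplectic matrix `J` (complex version). -/
def JmatC : Matrix (Fin 2) (Fin 2) ℂ := !![0, -1; 1, 0]

/-- `|J| = [[0,1],[1,0]]`. -/
def Jabs : Matrix (Fin 2) (Fin 2) ℝ := !![0, 1; 1, 0]

/-- The entrywise comparison `|U| ⪯ V`. -/
def entryAbsLe (U V : Matrix (Fin 2) (Fin 2) ℝ) : Prop :=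
  ∀ i j, |U i j| ≤ V i j

/-- The filter describing `t → b⁻`, `t` ranging over the reals, `b : EReal`. -/
def toBFilter (b : EReal) : Filter ℝ :=
  Filter.comap (fun t : ℝ => (t : EReal)) (nhdsWithin b (Set.Iio b))

/-- `H` is a Hamiltonian on `[a, b)`. -/
structure IsHamiltonian (a : ℝ) (b : EReal) (H : ℝ → Matrix (Fin 2) (Fin 2) ℝ) : Prop where
  a_lt_b : (a : EReal) < b
  posSemidef : ∀ᵐ (t : ℝ) ∂volume, a ≤ t → (t : EReal) < b → (H t).PosSemidef
  locInt : ∀ (i j : Fin 2) (t : ℝ), a ≤ t → (t : EReal) < b →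
    IntervalIntegrable (fun s => H s i j) volume a t
  zero_null : volume {t : ℝ | a ≤ t ∧ (t : EReal) < b ∧ H t = 0} = 0
  limit_point : (∫⁻ t in {t : ℝ | a ≤ t ∧ (t : EReal) < b},
    ENNReal.ofReal ((H t).trace)) = ⊤

/-- `m1(t) = ∫_a^t h1`. -/
def m1 (a : ℝ) (H : ℝ → Matrix (Fin 2) (Fin 2) ℝ) (t : ℝ) : ℝ := ∫ s in a..t, H s 0 0

/-- `m2(t) = ∫_a^t h2`. -/
def m2 (a : ℝ) (H : ℝ → Matrix (Fin 2) (Fin 2) ℝ) (t : ℝ) : ℝ := ∫ s in a..t, H s 1 1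

/-- `m3(t) = ∫_a^t h3`. -/
def m3 (a : ℝ) (H : ℝ → Matrix (Fin 2) (Fin 2) ℝ) (t : ℝ) : ℝ := ∫ s in a..t, H s 0 1

/-- `M(t) = ∫_a^t H(s) ds`. -/
def Mmat (a : ℝ) (H : ℝ → Matrix (Fin 2) (Fin 2) ℝ) (t : ℝ) : Matrix (Fin 2) (Fin 2) ℝ :=
  !![m1 a H t, m3 a H t; m3 a H t, m2 a H t]

/-- Neither diagonal entry of `H` vanishes a.e. on any neighbourhood of `a`. -/
def DiagNonVanishing (a : ℝ) (b : EReal) (H : ℝ → Matrix (Fin 2) (Fin 2) ℝ) : Prop :=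
  (∀ t : ℝ, a < t → (t : EReal) < b →
    ¬ ∀ᵐ s ∂(volume.restrict (Set.Ioo a t)), H s 0 0 = 0) ∧
  (∀ t : ℝ, a < t → (t : EReal) < b →
    ¬ ∀ᵐ s ∂(volume.restrict (Set.Ioo a t)), H s 1 1 = 0)

/-- `W` is the fundamental solution of `W(t,z)J − J = z ∫_a^t W(s,z)H(s) ds`. -/
def IsFundamentalSolution (a : ℝ) (b : EReal) (H : ℝ → Matrix (Fin 2) (Fin 2) ℝ)
    (W : ℝ → ℂ → Matrix (Fin 2) (Fin 2) ℂ) : Prop :=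
  ∀ (z : ℂ) (t : ℝ), a ≤ t → (t : EReal) < b →
    W t z * JmatC - JmatC =
      z • Matrix.of fun i j =>
        ∫ s in a..t, (W s z * (H s).map (fun x : ℝ => (x : ℂ))) i j

/-- `qH` is the Weyl coefficient of the Hamiltonian `H`. -/
def IsWeylCoefficient (a : ℝ) (b : EReal) (H : ℝ → Matrix (Fin 2) (Fin 2) ℝ)
    (qH : ℂ → ℂ) : Prop :=
  ∃ W : ℝ → ℂ → Matrix (Fin 2) (Fin 2) ℂ,
    IsFundamentalSolution a b H W ∧
    ∀ z : ℂ, z.im ≠ 0 → ∀ ζ : ℂ, 0 ≤ ζ.im →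
      Tendsto (fun t : ℝ =>
          (W t z 0 0 * ζ + W t z 0 1) / (W t z 1 0 * ζ + W t z 1 1))
        (toBFilter b) (nhds (qH z))

/-- `μ` is the spectral measure of `H`, i.e. the measure in the Herglotz
representation of the Weyl coefficient of `H`. -/
def IsSpectralMeasure (a : ℝ) (b : EReal) (H : ℝ → Matrix (Fin 2) (Fin 2) ℝ)
    (μ : Measure ℝ) : Prop :=
  ∃ qH : ℂ → ℂ, IsWeylCoefficient a b H qH ∧
    (∫⁻ t : ℝ, ENNReal.ofReal (1 / (1 + t ^ 2)) ∂μ) < ⊤ ∧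
    ∃ α β : ℝ, 0 ≤ β ∧ ∀ z : ℂ, z.im ≠ 0 →
      qH z = (α : ℂ) + (β : ℂ) * z +
        ∫ t : ℝ, (1 / ((t : ℂ) - z) - (t : ℂ) / (1 + (t : ℂ) ^ 2)) ∂μ

/-- `μ↔(r) = μ((−r, r))`. -/
def muSym (μ : Measure ℝ) (r : ℝ) : ℝ≥0∞ := μ (Set.Ioo (-r) r)

/-- Poisson integral of a measure. -/
def poisson (μ : Measure ℝ) (z : ℂ) : ℝ := ∫ t : ℝ, (1 / ((t : ℂ) - z)).im ∂μ

/-- `g : (0,∞) → (0,∞)` is regularly varying with index `ρ`. -/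
def RegularlyVarying (g : ℝ → ℝ) (ρ : ℝ) : Prop :=
  Measurable g ∧ (∀ r : ℝ, 0 < r → 0 < g r) ∧
  ∀ l : ℝ, 0 < l → Tendsto (fun r : ℝ => g (l * r) / g r) atTop (nhds (l ^ ρ))

/-- `g⋆(r) = ∫_1^r t/g(t) dt`. -/
def gstar (g : ℝ → ℝ) (r : ℝ) : ℝ := ∫ t in (1:ℝ)..r, t / g t

/-- The Kac class `𝓜_g`. -/
def memMg (g : ℝ → ℝ) (μ : Measure ℝ) : Prop :=
  (∫⁻ r in Set.Ici (1:ℝ), ENNReal.ofReal (1 / g r)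
    ∂(Measure.map (fun t : ℝ => |t|) μ)) < ⊤

/-- The class `𝓜̂_g`. -/
def memMhat (g : ℝ → ℝ) (μ : Measure ℝ) : Prop :=
  (∫⁻ r in Set.Ioi (1:ℝ), muSym μ r * ENNReal.ofReal (gstar g r / r ^ 3)) < ⊤

/-- The class `𝓕_g`: `μ↔(r) = O(g(r))`. -/
def memFg (g : ℝ → ℝ) (μ : Measure ℝ) : Prop :=
  ∃ C : ℝ, ∀ᶠ r in atTop, muSym μ r ≤ ENNReal.ofReal (C * g r)

/-- The class `𝓕_g⁰`: `μ↔(r) = o(g(r))`. -/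
def memFg0 (g : ℝ → ℝ) (μ : Measure ℝ) : Prop :=
  ∀ ε : ℝ, 0 < ε → ∀ᶠ r in atTop, muSym μ r ≤ ENNReal.ofReal (ε * g r)

/-- `M⁺(t)`. -/
def MplusMat (a : ℝ) (H : ℝ → Matrix (Fin 2) (Fin 2) ℝ) (t : ℝ) :
    Matrix (Fin 2) (Fin 2) ℝ :=
  !![m1 a H t, Real.sqrt (m1 a H t * m2 a H t);
     Real.sqrt (m1 a H t * m2 a H t), m2 a H t]

/-- `m⁺(t) = 2√(m1(t)m2(t))`. -/
def mplus (a : ℝ) (H : ℝ → Matrix (Fin 2) (Fin 2) ℝ) (t : ℝ) : ℝ :=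
  2 * Real.sqrt (m1 a H t * m2 a H t)

/-- `W` is the sequence of power series coefficients of the fundamental solution:
`W_0 = I`, `W_{n+1}(t) = (∫_a^t W_n H)·(−J)`. -/
def IsCoeffSeq (a : ℝ) (H : ℝ → Matrix (Fin 2) (Fin 2) ℝ)
    (W : ℕ → ℝ → Matrix (Fin 2) (Fin 2) ℝ) : Prop :=
  (∀ t : ℝ, W 0 t = 1) ∧
  ∀ (n : ℕ) (t : ℝ),
    W (n + 1) t = (Matrix.of fun i j => ∫ s in a..t, (W n s * H s) i j) * (-Jmat)

/-- Entrywise integral of a matrix-valued function. -/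
def intMat (f : ℝ → Matrix (Fin 2) (Fin 2) ℝ) (a t : ℝ) : Matrix (Fin 2) (Fin 2) ℝ :=
  Matrix.of fun i j => ∫ s in a..t, f s i j

/-- `α_{n,m}(t) = ∫_a^t W_n H W_m* ds`. -/
def alphaMat (a : ℝ) (H : ℝ → Matrix (Fin 2) (Fin 2) ℝ)
    (W : ℕ → ℝ → Matrix (Fin 2) (Fin 2) ℝ) (n m : ℕ) (t : ℝ) :
    Matrix (Fin 2) (Fin 2) ℝ :=
  intMat (fun s => W n s * H s * (W m s)ᵀ) a t

/-- `β_{n,m}(t) = W_n(t) J W_m(t)*`. -/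
def betaMat (W : ℕ → ℝ → Matrix (Fin 2) (Fin 2) ℝ) (n m : ℕ) (t : ℝ) :
    Matrix (Fin 2) (Fin 2) ℝ :=
  W n t * Jmat * (W m t)ᵀ

/-- `∇(t,z) = ∫_a^t W(s,z) H(s) W(s,z)* ds`. -/
def nablaMat (a : ℝ) (H : ℝ → Matrix (Fin 2) (Fin 2) ℝ)
    (W : ℝ → ℂ → Matrix (Fin 2) (Fin 2) ℂ) (t : ℝ) (z : ℂ) :
    Matrix (Fin 2) (Fin 2) ℂ :=
  Matrix.of fun i j =>
    ∫ s in a..t, (W s z * (H s).map (fun x : ℝ => (x : ℂ)) * (W s z)ᴴ) i j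

/-- Generalised inverse of `f : [a,b) → ℝ`. -/
def genInv (a : ℝ) (b : EReal) (f : ℝ → ℝ) (y : ℝ) : ℝ :=
  sInf {x : ℝ | a ≤ x ∧ (x : EReal) < b ∧ y ≤ f x}

/-- Generalised inverse of `f : [0,b) → [0,∞]`. -/
def genInvE (b : EReal) (f : ℝ → ℝ≥0∞) (y : ℝ) : ℝ :=
  sInf {x : ℝ | 0 ≤ x ∧ (x : EReal) < b ∧ ENNReal.ofReal y ≤ f x}

/-- If `x ↦ u x` solves the linear Volterra system `u = u₀ + ∫ k u` on `[a, t]`, with the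
convention that the integral of a non-integrable function is zero, and the kernel is integrable,
then the integrands `k u` are integrable. -/
theorem intervalIntegrable_of_volterra {ι : Type*} [Fintype ι] {a t : ℝ} (hat : a ≤ t)
    {k : ι → ι → ℝ → ℂ} {u : ι → ℝ → ℂ} {u₀ : ι → ℂ}
    (hk : ∀ i j, IntervalIntegrable (k i j) volume a t)
    (hu : ∀ i, ∀ s ∈ Icc a t, u i s = u₀ i + ∫ r in a..s, ∑ j, k i j r * u j r) (i : ι) :
    IntervalIntegrable (fun r => ∑ j, k i j r * u j r) volume a t := by
  set g : ι → ℝ → ℂ := fun i r => ∑ j, k i j r * u j r with hg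
  have hkint : ∀ i j x y, a ≤ x → x ≤ y → y ≤ t → IntervalIntegrable (k i j) volume x y := by
    intro i j x y h1 h2 h3
    refine (hk i j).mono_set ?_
    rw [uIcc_of_le h2, uIcc_of_le hat]
    exact Icc_subset_Icc h1 h3
  -- a solution that is continuous and bounded on `(x, y)` has integrable right side
  have key : ∀ x y, a ≤ x → x ≤ y → y ≤ t → (∀ j, ContinuousOn (u j) (Ioo x y)) →
      (∀ j, ∃ C, ∀ s ∈ Ioo x y, ‖u j s‖ ≤ C) → ∀ i, IntervalIntegrable (g i) volume x y := by
    intro x y h1 h2 h3 hc hb i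
    rw [intervalIntegrable_iff_integrableOn_Ioo_of_le h2]
    refine integrable_finsetSum _ fun j _ => ?_
    obtain ⟨C, hC⟩ := hb j
    refine Integrable.mul_bdd (c := C) ?_ ((hc j).aestronglyMeasurable measurableSet_Ioo) ?_
    · exact (intervalIntegrable_iff_integrableOn_Ioo_of_le h2).1 (hkint i j x y h1 h2 h3)
    · exact (ae_restrict_iff' measurableSet_Ioo).2 (Eventually.of_forall hC)
  have hcont : ∀ j s, a ≤ s → s ≤ t → IntervalIntegrable (g j) volume a s →
      ContinuousOn (u j) (Icc a s) := by
    intro j s h1 h2 hint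
    have h := intervalIntegral.continuousOn_primitive_interval' hint
      (left_mem_uIcc : a ∈ uIcc a s)
    rw [uIcc_of_le h1] at h
    exact (continuousOn_const.add h).congr fun r hr => hu j r ⟨hr.1, hr.2.trans h2⟩
  set S : Set ℝ := {s | ∀ j, IntervalIntegrable (g j) volume a s} with hS
  have hmono : ∀ s ∈ S, ∀ r, a ≤ r → r ≤ s → r ∈ S := by
    intro s hs r h1 h2 j
    refine (hs j).mono_set ?_
    rw [uIcc_of_le h1, uIcc_of_le (h1.trans h2)]
    exact Icc_subset_Icc le_rfl h2
  suffices Icc a t ⊆ S from this ⟨hat, le_rfl⟩ i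
  refine IsClosed.Icc_subset_of_forall_exists_gt ?_ (fun j => by simp) ?_
  · refine isClosed_of_closure_subset fun T hT => ?_
    have hTat : T ∈ Icc a t :=
      closure_minimal (inter_subset_right) isClosed_Icc hT
    refine ⟨?_, hTat⟩
    by_cases hex : ∃ s ∈ S, T ≤ s
    · obtain ⟨s, hs, hTs⟩ := hex
      exact hmono s hs T hTat.1 hTs
    push Not at hex
    have haT : a < T := hex a (fun j => by simp)
    have hlt : ∀ s, a ≤ s → s < T → s ∈ S := by
      intro s h1 h2
      obtain ⟨r, hr1, hr2⟩ := mem_closure_iff.1 hT (Ioi s) isOpen_Ioi h2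
      exact hmono r hr2.1 s h1 (le_of_lt hr1)
    -- choose `δ` close to `T`
    set K : ℝ → ℝ := fun r => ∑ i, ∑ j, ‖k i j r‖ with hK
    have hK0 : ∀ r, 0 ≤ K r := fun r =>
      Finset.sum_nonneg fun i _ => Finset.sum_nonneg fun j _ => norm_nonneg _
    have hKint : IntervalIntegrable K volume a T := by
      rw [intervalIntegrable_iff]
      refine integrable_finsetSum _ fun i _ => integrable_finsetSum _ fun j _ => ?_
      exact (intervalIntegrable_iff.1 (hkint i j a T le_rfl hTat.1 hTat.2)).norm
    obtain ⟨δ, haδ, hδT, hδ⟩ : ∃ δ, a ≤ δ ∧ δ < T ∧ ∫ r in δ..T, K r < 1 / 2 := by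
      have h := intervalIntegral.continuousOn_primitive_interval' hKint
        (left_mem_uIcc : a ∈ uIcc a T)
      rw [uIcc_of_le haT.le] at h
      have h1 : Tendsto (fun s => ∫ r in a..s, K r) (𝓝[<] T) (𝓝 (∫ r in a..T, K r)) :=
        (h T ⟨haT.le, le_rfl⟩).mono_left (by
          rw [← nhdsWithin_Ico_eq_nhdsLT haT]
          exact nhdsWithin_mono _ Ico_subset_Icc_self)
      have h2 := h1.eventually (lt_mem_nhds (show (∫ r in a..T, K r) - 1 / 2 < _ by linarith))
      obtain ⟨δ, hδ1, hδ2⟩ := (h2.and (Ico_mem_nhdsLT haT)).exists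
      refine ⟨δ, hδ2.1, hδ2.2, ?_⟩
      have h3 := intervalIntegral.integral_add_adjacent_intervals (a := a) (b := δ) (c := T)
        (f := K) (μ := volume)
        (hKint.mono_set (by
          rw [uIcc_of_le hδ2.1, uIcc_of_le haT.le]; exact Icc_subset_Icc le_rfl hδ2.2.le))
        (hKint.mono_set (by
          rw [uIcc_of_le hδ2.2.le, uIcc_of_le haT.le]; exact Icc_subset_Icc hδ2.1 le_rfl))
      linarith
    have hbound : ∀ s ∈ Ico δ T, ‖fun j => u j s‖ ≤ 2 * ‖fun j => u j δ‖ := by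
      intro s hs
      have hsS := hlt s (haδ.trans hs.1) hs.2
      have hc : ContinuousOn (fun r => ‖fun j => u j r‖) (Icc δ s) := by
        refine ContinuousOn.norm (continuousOn_pi.2 fun j => ?_)
        exact (hcont j s (haδ.trans hs.1) (hs.2.le.trans hTat.2) (hsS j)).mono
          (Icc_subset_Icc haδ le_rfl)
      obtain ⟨m, hm, hmax⟩ := isCompact_Icc.exists_isMaxOn ⟨δ, le_rfl, hs.1⟩ hc
      have hms : ∀ r ∈ Icc δ s, ‖fun j => u j r‖ ≤ ‖fun j => u j m‖ := hmax
      refine (hms s ⟨hs.1, le_rfl⟩).trans ?_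
      set M := ‖fun j => u j m‖ with hM
      have hM0 : 0 ≤ M := norm_nonneg _
      have hmT : m < T := hm.2.trans_lt hs.2
      have hle : M ≤ ‖fun j => u j δ‖ + M * (1 / 2) := by
        refine (pi_norm_le_iff_of_nonneg (by positivity)).2 fun j => ?_
        have hSm := hlt m (haδ.trans hm.1) hmT
        have hSδ := hlt δ haδ hδT
        have hdiff : u j m = u j δ + ∫ r in δ..m, g j r := by
          rw [hu j m ⟨haδ.trans hm.1, hmT.le.trans hTat.2⟩,
            hu j δ ⟨haδ, hδT.le.trans hTat.2⟩, add_assoc,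
            intervalIntegral.integral_add_adjacent_intervals (hSδ j)
              ((hSδ j).symm.trans (hSm j))]
        have hint : ‖∫ r in δ..m, g j r‖ ≤ ∫ r in δ..m, M * K r := by
          refine intervalIntegral.norm_integral_le_of_norm_le hm.1 ?_ ?_
          · refine Eventually.of_forall fun r hr => ?_
            refine (norm_sum_le _ _).trans ?_
            calc ∑ l, ‖k j l r * u l r‖ ≤ ∑ l, ‖k j l r‖ * M := by
                  refine Finset.sum_le_sum fun l _ => ?_
                  rw [norm_mul]
                  refine mul_le_mul_of_nonneg_left ?_ (norm_nonneg _)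
                  exact (norm_le_pi_norm (fun j => u j r) l).trans
                    (hms r ⟨hr.1.le, hr.2.trans hm.2⟩)
              _ = M * ∑ l, ‖k j l r‖ := by rw [← Finset.sum_mul, mul_comm]
              _ ≤ M * K r := by
                  refine mul_le_mul_of_nonneg_left ?_ hM0
                  exact Finset.single_le_sum (f := fun i => ∑ l, ‖k i l r‖)
                    (fun i _ => Finset.sum_nonneg fun l _ => norm_nonneg _) (Finset.mem_univ j)
          · refine (hKint.mono_set ?_).const_mul M
            rw [uIcc_of_le hm.1, uIcc_of_le haT.le]
            exact Icc_subset_Icc haδ hmT.le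
        have hK2 : ∫ r in δ..m, K r ≤ ∫ r in δ..T, K r := by
          refine intervalIntegral.integral_mono_interval le_rfl hm.1 hmT.le
            (Eventually.of_forall hK0) (hKint.mono_set ?_)
          rw [uIcc_of_le hδT.le, uIcc_of_le haT.le]
          exact Icc_subset_Icc haδ le_rfl
        rw [intervalIntegral.integral_const_mul] at hint
        rw [hdiff]
        refine (norm_add_le _ _).trans <| add_le_add (norm_le_pi_norm (fun j => u j δ) j) ?_
        exact hint.trans (mul_le_mul_of_nonneg_left (by linarith) hM0)
      linarith
    intro j
    refine (hlt δ haδ hδT j).trans (key δ T haδ hδT.le hTat.2 (fun l => ?_) (fun l => ?_) j)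
    · intro s hs
      obtain ⟨r, hr1, hr2⟩ := exists_between hs.2
      refine ((hcont l r (haδ.trans (hs.1.trans hr1).le) (hr2.le.trans hTat.2)
        (hlt r (haδ.trans (hs.1.trans hr1).le) hr2 l)).continuousAt
          (Icc_mem_nhds (haδ.trans_lt hs.1) hr1)).continuousWithinAt
    · exact ⟨2 * ‖fun j => u j δ‖, fun s hs =>
        (norm_le_pi_norm (fun j => u j s) l).trans (hbound s ⟨hs.1.le, hs.2⟩)⟩
  · rintro x ⟨hxS, hx⟩ y hy
    have hev : ∀ j, ∀ᶠ r in 𝓝[>] x, ContinuousOn (u j) (Ioo x r) ∧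
        ∃ C, ∀ s ∈ Ioo x r, ‖u j s‖ ≤ C := by
      intro j
      by_cases hj : ∃ r ∈ Ioc x t, IntervalIntegrable (g j) volume a r
      · obtain ⟨r, hr, hint⟩ := hj
        have hc := hcont j r (hx.1.trans hr.1.le) hr.2 hint
        obtain ⟨C, hC⟩ := isCompact_Icc.exists_bound_of_continuousOn hc
        filter_upwards [Ioc_mem_nhdsGT hr.1] with r' hr'
        have hsub : Ioo x r' ⊆ Icc a r := fun s hs => ⟨hx.1.trans hs.1.le, hs.2.le.trans hr'.2⟩
        exact ⟨hc.mono hsub, C, fun s hs => hC s (hsub hs)⟩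
      · push Not at hj
        filter_upwards [Ioc_mem_nhdsGT hx.2] with r' hr'
        have hconst : ∀ s ∈ Ioo x r', u j s = u₀ j := by
          intro s hs
          have hst : s ≤ t := hs.2.le.trans hr'.2
          rw [hu j s ⟨hx.1.trans hs.1.le, hst⟩,
            intervalIntegral.integral_undef (hj s ⟨hs.1, hst⟩), add_zero]
        exact ⟨continuousOn_const.congr hconst, ‖u₀ j‖, fun s hs => by rw [hconst s hs]⟩
    obtain ⟨r, hr1, hr2⟩ := ((eventually_all.2 hev).and
      (Ioc_mem_nhdsGT (lt_min hx.2 hy))).exists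
    refine ⟨r, fun j => ?_, hr2.1, hr2.2.trans (min_le_right _ _)⟩
    exact (hxS j).trans (key x r hx.1 hr2.1.le (hr2.2.trans (min_le_left _ _))
      (fun j => (hr1 j).1) (fun j => (hr1 j).2) j)

/-- Product rule for primitives of real integrable functions. -/
theorem integral_primitive_mul_real {f g : ℝ → ℝ} {a t : ℝ} (p q : ℝ)
    (hf : IntervalIntegrable f volume a t) (hg : IntervalIntegrable g volume a t) :
    ∫ s in a..t, (f s * (q + ∫ r in a..s, g r) + (p + ∫ r in a..s, f r) * g s) =
      (p + ∫ r in a..t, f r) * (q + ∫ r in a..t, g r) - p * q := by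
  have hc : ∀ c : ℝ, AbsolutelyContinuousOnInterval (fun _ : ℝ => c) a t := fun c =>
    (LipschitzWith.const c).lipschitzOnWith.absolutelyContinuousOnInterval
  have hP := (hc p).add (hf.absolutelyContinuousOnInterval_intervalIntegral left_mem_uIcc)
  have hQ := (hc q).add (hg.absolutelyContinuousOnInterval_intervalIntegral left_mem_uIcc)
  have h := hP.integral_deriv_mul_eq_sub hQ
  simp only [Pi.add_apply, intervalIntegral.integral_same, add_zero] at h
  rw [← h]
  refine intervalIntegral.integral_congr_ae ?_
  filter_upwards [hf.ae_hasDerivAt_integral, hg.ae_hasDerivAt_integral] with s h1 h2 hs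
  have e1 := ((h1 (uIoc_subset_uIcc hs) a left_mem_uIcc).const_add p).deriv
  have e2 := ((h2 (uIoc_subset_uIcc hs) a left_mem_uIcc).const_add q).deriv
  simp only [Pi.add_def, e1, e2]

/-- `P` is a primitive of the integrable function `f` on `[a, t]`. -/
structure IsPrimitiveOn (P f : ℝ → ℂ) (a t : ℝ) : Prop where
  le : a ≤ t
  integrable : IntervalIntegrable f volume a t
  eq_add : ∀ s ∈ Icc a t, P s = P a + ∫ r in a..s, f r

namespace IsPrimitiveOn

variable {P Q f g : ℝ → ℂ} {a t : ℝ}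

theorem mono {s : ℝ} (hP : IsPrimitiveOn P f a t) (hs : s ∈ Icc a t) :
    IsPrimitiveOn P f a s where
  le := hs.1
  integrable := hP.integrable.mono_set (by
    rw [uIcc_of_le hs.1, uIcc_of_le hP.le]; exact Icc_subset_Icc le_rfl hs.2)
  eq_add r hr := hP.eq_add r ⟨hr.1, hr.2.trans hs.2⟩

theorem continuousOn (hP : IsPrimitiveOn P f a t) : ContinuousOn P (uIcc a t) := by
  have h := intervalIntegral.continuousOn_primitive_interval' hP.integrable
    (left_mem_uIcc : a ∈ uIcc a t)
  refine (continuousOn_const.add h).congr fun r hr => hP.eq_add r ?_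
  rwa [uIcc_of_le hP.le] at hr

theorem congr_ae (hP : IsPrimitiveOn P f a t) (h : ∀ᵐ s, s ∈ uIoc a t → f s = g s) :
    IsPrimitiveOn P g a t where
  le := hP.le
  integrable := hP.integrable.congr_ae ((ae_restrict_iff' measurableSet_uIoc).2 h)
  eq_add s hs := by
    rw [hP.eq_add s hs]
    congr 1
    refine intervalIntegral.integral_congr_ae ?_
    filter_upwards [h] with r hr hrs
    refine hr ?_
    rw [uIoc_of_le hs.1] at hrs
    rw [uIoc_of_le hP.le]
    exact ⟨hrs.1, hrs.2.trans hs.2⟩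

theorem sub (hP : IsPrimitiveOn P f a t) (hQ : IsPrimitiveOn Q g a t) :
    IsPrimitiveOn (fun s => P s - Q s) (fun s => f s - g s) a t where
  le := hP.le
  integrable := hP.integrable.sub hQ.integrable
  eq_add s hs := by
    rw [intervalIntegral.integral_sub (hP.mono hs).integrable (hQ.mono hs).integrable,
      hP.eq_add s hs, hQ.eq_add s hs]
    ring

theorem conj (hP : IsPrimitiveOn P f a t) :
    IsPrimitiveOn (fun s => star (P s)) (fun s => star (f s)) a t where
  le := hP.le
  integrable := by
    have h := hP.integrable
    rw [intervalIntegrable_iff] at h ⊢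
    exact (Complex.conjCLE : ℂ →L[ℝ] ℂ).integrable_comp h
  eq_add s hs := by
    have h := (Complex.conjCLE : ℂ →L[ℝ] ℂ).intervalIntegral_comp_comm (hP.mono hs).integrable
    simp only [ContinuousLinearEquiv.coe_coe, Complex.conjCLE_apply] at h
    simp only [RCLike.star_def]
    rw [h, hP.eq_add s hs, map_add]

theorem mul_eq (hP : IsPrimitiveOn P f a t) (hQ : IsPrimitiveOn Q g a t) :
    P t * Q t = P a * Q a + ∫ s in a..t, (f s * Q s + P s * g s) := by
  have hf1 : IntervalIntegrable (fun s => (f s).re) volume a t := by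
    have h := hP.integrable
    rw [intervalIntegrable_iff] at h ⊢
    exact h.re
  have hf2 : IntervalIntegrable (fun s => (f s).im) volume a t := by
    have h := hP.integrable
    rw [intervalIntegrable_iff] at h ⊢
    exact h.im
  have hg1 : IntervalIntegrable (fun s => (g s).re) volume a t := by
    have h := hQ.integrable
    rw [intervalIntegrable_iff] at h ⊢
    exact h.re
  have hg2 : IntervalIntegrable (fun s => (g s).im) volume a t := by
    have h := hQ.integrable
    rw [intervalIntegrable_iff] at h ⊢
    exact h.im
  have hre : ∀ {R h : ℝ → ℂ}, IsPrimitiveOn R h a t → ∀ s ∈ Icc a t,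
      (R s).re = (R a).re + ∫ r in a..s, (h r).re := fun {R h} hR s hs => by
    have e := Complex.reCLM.intervalIntegral_comp_comm (hR.mono hs).integrable
    simp only [Complex.reCLM_apply] at e
    rw [e, hR.eq_add s hs, Complex.add_re]
  have him : ∀ {R h : ℝ → ℂ}, IsPrimitiveOn R h a t → ∀ s ∈ Icc a t,
      (R s).im = (R a).im + ∫ r in a..s, (h r).im := fun {R h} hR s hs => by
    have e := Complex.imCLM.intervalIntegral_comp_comm (hR.mono hs).integrable
    simp only [Complex.imCLM_apply] at e
    rw [e, hR.eq_add s hs, Complex.add_im]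
  have hreal : ∀ {A B p q : ℝ → ℝ}, IntervalIntegrable p volume a t →
      IntervalIntegrable q volume a t → (∀ s ∈ Icc a t, A s = A a + ∫ r in a..s, p r) →
      (∀ s ∈ Icc a t, B s = B a + ∫ r in a..s, q r) →
      IntervalIntegrable (fun s => p s * B s + A s * q s) volume a t ∧
      ∫ s in a..t, (p s * B s + A s * q s) = A t * B t - A a * B a := by
    intro A B p q hp hq hA hB
    have hAc : ContinuousOn A (uIcc a t) := by
      refine (continuousOn_const.add (intervalIntegral.continuousOn_primitive_interval' hp
        (left_mem_uIcc : a ∈ uIcc a t))).congr fun r hr => hA r ?_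
      rwa [uIcc_of_le hP.le] at hr
    have hBc : ContinuousOn B (uIcc a t) := by
      refine (continuousOn_const.add (intervalIntegral.continuousOn_primitive_interval' hq
        (left_mem_uIcc : a ∈ uIcc a t))).congr fun r hr => hB r ?_
      rwa [uIcc_of_le hP.le] at hr
    refine ⟨(hp.mul_continuousOn hBc).add (hq.continuousOn_mul hAc), ?_⟩
    rw [hA t ⟨hP.le, le_rfl⟩, hB t ⟨hP.le, le_rfl⟩, ← integral_primitive_mul_real _ _ hp hq]
    refine intervalIntegral.integral_congr fun s hs => ?_
    rw [uIcc_of_le hP.le] at hs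
    rw [← hA s hs, ← hB s hs]
  have hint : IntervalIntegrable (fun s => f s * Q s + P s * g s) volume a t :=
    (hP.integrable.mul_continuousOn hQ.continuousOn).add
      (hQ.integrable.continuousOn_mul hP.continuousOn)
  obtain ⟨i1, e1⟩ := hreal hf1 hg1 (hre hP) (hre hQ)
  obtain ⟨i2, e2⟩ := hreal hf2 hg2 (him hP) (him hQ)
  obtain ⟨i3, e3⟩ := hreal hf1 hg2 (hre hP) (him hQ)
  obtain ⟨i4, e4⟩ := hreal hf2 hg1 (him hP) (hre hQ)
  have er := Complex.reCLM.intervalIntegral_comp_comm hint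
  have ei := Complex.imCLM.intervalIntegral_comp_comm hint
  simp only [Complex.reCLM_apply, Complex.imCLM_apply] at er ei
  have er' := intervalIntegral.integral_sub i1 i2
  have ei' := intervalIntegral.integral_add i3 i4
  apply Complex.ext
  · rw [Complex.add_re, ← er, Complex.mul_re, Complex.mul_re]
    have : ∫ s in a..t, (f s * Q s + P s * g s).re = ∫ s in a..t,
        (((f s).re * (Q s).re + (P s).re * (g s).re) -
          ((f s).im * (Q s).im + (P s).im * (g s).im)) :=
      intervalIntegral.integral_congr fun s _ => by
        simp only [Complex.add_re, Complex.mul_re]; ring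
    linarith
  · rw [Complex.add_im, ← ei, Complex.mul_im, Complex.mul_im]
    have : ∫ s in a..t, (f s * Q s + P s * g s).im = ∫ s in a..t,
        (((f s).re * (Q s).im + (P s).re * (g s).im) +
          ((f s).im * (Q s).re + (P s).im * (g s).re)) :=
      intervalIntegral.integral_congr fun s _ => by
        simp only [Complex.add_im, Complex.mul_im]; ring
    linarith

theorem mul (hP : IsPrimitiveOn P f a t) (hQ : IsPrimitiveOn Q g a t) :
    IsPrimitiveOn (fun s => P s * Q s) (fun s => f s * Q s + P s * g s) a t where
  le := hP.le
  integrable := (hP.integrable.mul_continuousOn hQ.continuousOn).add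
      (hQ.integrable.continuousOn_mul hP.continuousOn)
  eq_add _ hs := (hP.mono hs).mul_eq (hQ.mono hs)

end IsPrimitiveOn

/-- The image of the closed upper half-plane together with `∞` under a fractional linear
transformation of determinant one whose pole lies in the open lower half-plane. -/
theorem image_upperHalfPlane_eq_closedBall {p q r s : ℂ} (hdet : p * s - q * r = 1) {k : ℝ}
    (hk : 0 < k) {c : ℂ} (hE : s * star r - r * star s = 2 * Complex.I * k)
    (hc : q * star r - p * star s = 2 * Complex.I * k * c) :
    insert (p / r) {w : ℂ | ∃ ζ : ℂ, 0 ≤ ζ.im ∧ w = (p * ζ + q) / (r * ζ + s)} =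
      Metric.closedBall c (1 / (2 * k)) := by
  have hE0 : (2 * Complex.I * k : ℂ) ≠ 0 := by
    simp [Complex.I_ne_zero, hk.ne']
  have hEn : ‖(2 * Complex.I * k : ℂ)‖ = 2 * k := by
    simp [abs_of_pos hk]
  have hr : r ≠ 0 := by
    rintro rfl
    simp at hE
    exact hk.ne' hE
  have him : s.im * r.re - s.re * r.im = k := by
    have := congrArg Complex.im hE
    simp at this
    linarith
  have hnum : ∀ ζ : ℂ, Complex.normSq (r * ζ + s) - Complex.normSq (star r * ζ + star s) =
      4 * k * ζ.im := by
    intro ζ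
    rw [← him]
    simp [Complex.normSq_apply]
    ring
  have hdiff : ∀ ζ : ℂ, r * ζ + s ≠ 0 → (p * ζ + q) / (r * ζ + s) - c =
      (star r * ζ + star s) / ((r * ζ + s) * (2 * Complex.I * k)) := by
    intro ζ hζ
    rw [eq_div_iff (mul_ne_zero hζ hE0)]
    have : ((p * ζ + q) / (r * ζ + s) - c) * ((r * ζ + s) * (2 * Complex.I * k)) =
        (p * ζ + q) * (2 * Complex.I * k) - (r * ζ + s) * (2 * Complex.I * k * c) := by
      rw [sub_mul, ← mul_assoc, div_mul_cancel₀ _ hζ]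
      ring
    rw [this, ← hc, ← hE]
    linear_combination (star r * ζ + star s) * hdet
  have hmem : ∀ ζ : ℂ, r * ζ + s ≠ 0 →
      ((p * ζ + q) / (r * ζ + s) ∈ Metric.closedBall c (1 / (2 * k)) ↔ 0 ≤ ζ.im) := by
    intro ζ hζ
    have hpos : 0 < ‖r * ζ + s‖ := norm_pos_iff.2 hζ
    rw [mem_closedBall_iff_norm, hdiff ζ hζ, norm_div, norm_mul, hEn,
      div_le_div_iff₀ (by positivity) (by positivity), one_mul,
      mul_le_mul_iff_left₀ (by positivity : (0 : ℝ) < 2 * k),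
      ← sq_le_sq₀ (norm_nonneg _) (norm_nonneg _), Complex.sq_norm, Complex.sq_norm,
      ← sub_nonneg, hnum]
    constructor
    · intro h
      by_contra hneg
      push Not at hneg
      nlinarith
    · intro h
      positivity
  ext w
  simp only [mem_insert_iff, mem_ofPred_eq]
  constructor
  · rintro (rfl | ⟨ζ, hζ, rfl⟩)
    · have : p / r - c = star r / (r * (2 * Complex.I * k)) := by
        rw [eq_div_iff (mul_ne_zero hr hE0)]
        have : (p / r - c) * (r * (2 * Complex.I * k)) =
            p * (2 * Complex.I * k) - r * (2 * Complex.I * k * c) := by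
          field_simp
        rw [this, ← hc, ← hE]
        linear_combination star r * hdet
      rw [mem_closedBall_iff_norm, this, norm_div, norm_mul, hEn, norm_star]
      have := norm_pos_iff.2 hr
      refine le_of_eq ?_
      field_simp
    · refine (hmem ζ ?_).2 hζ
      intro h0
      have h1 := hnum ζ
      rw [h0, map_zero] at h1
      have h2 : 0 ≤ 4 * k * ζ.im := by positivity
      have h3 := Complex.normSq_nonneg (star r * ζ + star s)
      have h4 : Complex.normSq (star r * ζ + star s) = 0 := by linarith
      rw [Complex.normSq_eq_zero] at h4
      apply hE0
      rw [← hE]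
      linear_combination star r * h0 - r * h4
  · intro hw
    by_cases h : w = p / r
    · exact Or.inl h
    right
    have hd : p - r * w ≠ 0 := by
      intro h0
      apply h
      rw [eq_div_iff hr]
      linear_combination -h0
    have hden : r * ((s * w - q) / (p - r * w)) + s = 1 / (p - r * w) := by
      field_simp
      linear_combination hdet
    have heq : w = (p * ((s * w - q) / (p - r * w)) + q) /
        (r * ((s * w - q) / (p - r * w)) + s) := by
      rw [hden, div_div_eq_mul_div, div_one, add_mul, mul_assoc, div_mul_cancel₀ _ hd]
      linear_combination (-w) * hdet
    refine ⟨(s * w - q) / (p - r * w), ?_, heq⟩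
    rw [← hmem _ (by rw [hden]; exact one_div_ne_zero hd), ← heq]
    exact hw

/-- Each entry of a fundamental solution is a primitive of the corresponding entry of
`z W H (-J)`. In particular `W H` is integrable. -/
theorem IsFundamentalSolution.isPrimitiveOn {a : ℝ} {b : EReal}
    {H : ℝ → Matrix (Fin 2) (Fin 2) ℝ} (hH : IsHamiltonian a b H)
    {W : ℝ → ℂ → Matrix (Fin 2) (Fin 2) ℂ} (hW : IsFundamentalSolution a b H W) (z : ℂ)
    {t : ℝ} (hat : a ≤ t) (htb : (t : EReal) < b) (i : Fin 2) :
    IsPrimitiveOn (fun s => W s z i 0)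
        (fun s => -z * (W s z i 0 * H s 0 1 + W s z i 1 * H s 1 1)) a t ∧
      IsPrimitiveOn (fun s => W s z i 1)
        (fun s => z * (W s z i 0 * H s 0 0 + W s z i 1 * H s 1 0)) a t := by
  have heq : ∀ s ∈ Icc a t,
      W s z i 0 = -JmatC i 1 +
        ∫ r in a..s, -z * (W r z i 0 * H r 0 1 + W r z i 1 * H r 1 1) ∧
      W s z i 1 = JmatC i 0 +
        ∫ r in a..s, z * (W r z i 0 * H r 0 0 + W r z i 1 * H r 1 0) := by
    intro s hs
    have h := hW z s hs.1 (lt_of_le_of_lt (EReal.coe_le_coe_iff.2 hs.2) htb)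
    have h0 := congrFun (congrFun h i) 0
    have h1 := congrFun (congrFun h i) 1
    have c00 : JmatC 0 0 = 0 := rfl
    have c01 : JmatC 0 1 = -1 := rfl
    have c10 : JmatC 1 0 = 1 := rfl
    have c11 : JmatC 1 1 = 0 := rfl
    simp only [Matrix.sub_apply, Matrix.mul_apply, Fin.sum_univ_two, c00, c01, c10, c11,
      Matrix.smul_apply, Matrix.of_apply, Matrix.map_apply, smul_eq_mul] at h0 h1
    rw [intervalIntegral.integral_const_mul, intervalIntegral.integral_const_mul]
    constructor
    · linear_combination -h1
    · linear_combination h0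
  have hHint : ∀ (i j : Fin 2) (c : ℂ),
      IntervalIntegrable (fun s => c * (H s i j : ℂ)) volume a t := by
    intro i j c
    have h := hH.locInt i j t hat htb
    rw [intervalIntegrable_iff] at h ⊢
    exact h.ofReal.const_mul c
  have hint := intervalIntegrable_of_volterra hat
    (k := ![![fun s => -z * H s 0 1, fun s => -z * H s 1 1],
      ![fun s => z * H s 0 0, fun s => z * H s 1 0]])
    (u := ![fun s => W s z i 0, fun s => W s z i 1])
    (u₀ := ![-JmatC i 1, JmatC i 0])
    (by
      intro j l
      fin_cases j <;> fin_cases l <;> exact hHint _ _ _)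
    (by
      intro j s hs
      obtain ⟨e0, e1⟩ := heq s hs
      fin_cases j
      · simp only [Fin.sum_univ_two]
        refine e0.trans ?_
        congr 1
        refine intervalIntegral.integral_congr fun r _ => ?_
        change _ = -z * H r 0 1 * W r z i 0 + -z * H r 1 1 * W r z i 1
        ring
      · simp only [Fin.sum_univ_two]
        refine e1.trans ?_
        congr 1
        refine intervalIntegral.integral_congr fun r _ => ?_
        change _ = z * H r 0 0 * W r z i 0 + z * H r 1 0 * W r z i 1
        ring)
  have ha := heq a ⟨le_rfl, hat⟩
  simp only [intervalIntegral.integral_same, add_zero] at ha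
  refine ⟨⟨hat, ?_, fun s hs => ?_⟩, ⟨hat, ?_, fun s hs => ?_⟩⟩
  · refine (hint 0).congr fun r _ => ?_
    simp only [Fin.sum_univ_two]
    change -z * H r 0 1 * W r z i 0 + -z * H r 1 1 * W r z i 1 = _
    ring
  · rw [ha.1]
    exact (heq s hs).1
  · refine (hint 1).congr fun r _ => ?_
    simp only [Fin.sum_univ_two]
    change z * H r 0 0 * W r z i 0 + z * H r 1 0 * W r z i 1 = _
    ring
  · rw [ha.2]
    exact (heq s hs).2

/-- A fundamental solution equals the identity at the left endpoint. -/
theorem IsFundamentalSolution.apply_left {a : ℝ} {b : EReal}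
    {H : ℝ → Matrix (Fin 2) (Fin 2) ℝ} (hab : (a : EReal) < b)
    {W : ℝ → ℂ → Matrix (Fin 2) (Fin 2) ℂ} (hW : IsFundamentalSolution a b H W) (z : ℂ) :
    W a z = 1 := by
  have h := hW z a le_rfl hab
  have h2 : JmatC * -JmatC = 1 := by
    ext i j
    fin_cases i <;> fin_cases j <;> simp [JmatC]
  have h1 : W a z * JmatC = JmatC := by
    rw [← sub_eq_zero, h]
    ext i j
    simp
  calc W a z = W a z * JmatC * -JmatC := by rw [Matrix.mul_assoc, h2, Matrix.mul_one]
    _ = 1 := by rw [h1, h2]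

section WeylDisc

variable {a : ℝ} {b : EReal} {H : ℝ → Matrix (Fin 2) (Fin 2) ℝ}
  {W : ℝ → ℂ → Matrix (Fin 2) (Fin 2) ℂ} {t : ℝ}

theorem IsHamiltonian.ae_uIoc_posSemidef (hH : IsHamiltonian a b H) (hat : a ≤ t)
    (htb : (t : EReal) < b) : ∀ᵐ s : ℝ, s ∈ uIoc a t → (H s).PosSemidef := by
  filter_upwards [hH.posSemidef] with s hs hst
  rw [uIoc_of_le hat] at hst
  exact hs hst.1.le (lt_of_le_of_lt (EReal.coe_le_coe_iff.2 hst.2) htb)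

theorem IsHamiltonian.ae_uIoc_symm (hH : IsHamiltonian a b H) (hat : a ≤ t)
    (htb : (t : EReal) < b) : ∀ᵐ s : ℝ, s ∈ uIoc a t → H s 1 0 = H s 0 1 := by
  filter_upwards [hH.ae_uIoc_posSemidef hat htb] with s hs hst
  simpa using ((hs hst).isHermitian.apply 1 0).symm

/-- The fundamental solution has determinant one. -/
theorem IsFundamentalSolution.det_eq_one (hH : IsHamiltonian a b H)
    (hW : IsFundamentalSolution a b H W) (z : ℂ) (hat : a ≤ t) (htb : (t : EReal) < b) :
    W t z 0 0 * W t z 1 1 - W t z 0 1 * W t z 1 0 = 1 := by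
  obtain ⟨p0, p1⟩ := hW.isPrimitiveOn hH z hat htb 0
  obtain ⟨q0, q1⟩ := hW.isPrimitiveOn hH z hat htb 1
  have h := (((p0.mul q1).sub (p1.mul q0)).congr_ae (g := fun _ => 0) (by
    filter_upwards [hH.ae_uIoc_symm hat htb] with s hs hst
    rw [hs hst]
    ring)).eq_add t ⟨hat, le_rfl⟩
  simpa [hW.apply_left hH.a_lt_b z] using h

/-- The identity `W J W* - J = (z - conj z) ∇`, entrywise. -/
theorem IsFundamentalSolution.mul_J_mul_conjTranspose (hH : IsHamiltonian a b H)
    (hW : IsFundamentalSolution a b H W) (z : ℂ) (hat : a ≤ t) (htb : (t : EReal) < b)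
    (i j : Fin 2) :
    W t z i 1 * star (W t z j 0) - W t z i 0 * star (W t z j 1) =
      JmatC i j + 2 * Complex.I * z.im * nablaMat a H W t z i j := by
  obtain ⟨p0, p1⟩ := hW.isPrimitiveOn hH z hat htb i
  obtain ⟨q0, q1⟩ := hW.isPrimitiveOn hH z hat htb j
  have h := (((p1.mul q0.conj).sub (p0.mul q1.conj)).congr_ae (g := fun s =>
      2 * Complex.I * z.im * (W s z * (H s).map (fun x : ℝ => (x : ℂ)) * (W s z)ᴴ) i j) (by
    filter_upwards [hH.ae_uIoc_symm hat htb] with s hs hst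
    have hz : (2 * Complex.I * z.im : ℂ) = z - star z := by
      rw [RCLike.star_def, Complex.sub_conj]
      push_cast
      ring
    simp only [hz, Matrix.mul_apply, Fin.sum_univ_two, Matrix.map_apply,
      Matrix.conjTranspose_apply, hs hst, star_mul', star_add, star_neg, RCLike.star_def,
      Complex.conj_ofReal]
    ring)).eq_add t ⟨hat, le_rfl⟩
  rw [h, intervalIntegral.integral_const_mul]
  simp only [nablaMat, Matrix.of_apply]
  congr 1
  rw [hW.apply_left hH.a_lt_b z]
  revert i j
  simp [Fin.forall_fin_two, JmatC]

/-- The quadratic form of a real `2 × 2` matrix at the complex vector with conjugate `(x, y)`. -/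
def hermForm (M : Matrix (Fin 2) (Fin 2) ℝ) (x y : ℂ) : ℝ :=
  Complex.normSq x * M 0 0 + Complex.normSq y * M 1 1 + 2 * M 0 1 * (x * star y).re

theorem normSq_le_mul_hermForm {M : Matrix (Fin 2) (Fin 2) ℝ} (hM : M.PosSemidef) (x y : ℂ) :
    Complex.normSq (x * M 0 0 + y * M 1 0) ≤ M 0 0 * hermForm M x y ∧
      Complex.normSq (x * M 0 1 + y * M 1 1) ≤ M 1 1 * hermForm M x y := by
  have hsymm : M 1 0 = M 0 1 := by simpa using (hM.isHermitian.apply 1 0).symm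
  have hdet := hM.det_nonneg
  rw [Matrix.det_fin_two, hsymm] at hdet
  have hx := mul_nonneg hdet (Complex.normSq_nonneg x)
  have hy := mul_nonneg hdet (Complex.normSq_nonneg y)
  simp only [hsymm, hermForm, Complex.normSq_apply, Complex.add_re, Complex.add_im,
    Complex.mul_re, Complex.mul_im, Complex.ofReal_re, Complex.ofReal_im, RCLike.star_def,
    Complex.conj_re, Complex.conj_im] at hx hy ⊢
  constructor <;> nlinarith

theorem hermForm_nonneg {M : Matrix (Fin 2) (Fin 2) ℝ} (hM : M.PosSemidef) (x y : ℂ) :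
    0 ≤ hermForm M x y := by
  have h1 := hM.diag_nonneg (i := 0)
  have h2 := hM.diag_nonneg (i := 1)
  obtain ⟨e1, e2⟩ := normSq_le_mul_hermForm hM x y
  by_contra! hneg
  have g1 : M 0 0 = 0 := by
    by_contra h
    nlinarith [Complex.normSq_nonneg (x * M 0 0 + y * M 1 0), lt_of_le_of_ne h1 (Ne.symm h)]
  have g2 : M 1 1 = 0 := by
    by_contra h
    nlinarith [Complex.normSq_nonneg (x * M 0 1 + y * M 1 1), lt_of_le_of_ne h2 (Ne.symm h)]
  have hsymm : M 1 0 = M 0 1 := by simpa using (hM.isHermitian.apply 1 0).symm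
  have hdet := hM.det_nonneg
  rw [Matrix.det_fin_two, hsymm, g1] at hdet
  have g3 : M 0 1 = 0 := by nlinarith
  simp [hermForm, g1, g2, g3] at hneg

/-- The lower right entry of `∇` is the integral of a nonnegative quadratic form. -/
theorem IsHamiltonian.nablaMat_one_one (hH : IsHamiltonian a b H)
    (W : ℝ → ℂ → Matrix (Fin 2) (Fin 2) ℂ) (z : ℂ) (hat : a ≤ t) (htb : (t : EReal) < b) :
    nablaMat a H W t z 1 1 = ((∫ s in a..t, hermForm (H s) (W s z 1 0) (W s z 1 1) : ℝ) : ℂ) := by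
  rw [← intervalIntegral.integral_ofReal]
  simp only [nablaMat, Matrix.of_apply]
  refine intervalIntegral.integral_congr_ae ?_
  filter_upwards [hH.ae_uIoc_symm hat htb] with s hs hst
  simp only [Matrix.mul_apply, Fin.sum_univ_two, Matrix.map_apply,
    Matrix.conjTranspose_apply, hs hst, hermForm]
  apply Complex.ext <;> simp [Complex.normSq_apply] <;> ring

/-- The integral of the quadratic form is positive if `h₂` does not vanish. -/
theorem IsFundamentalSolution.integral_hermForm_pos (hH : IsHamiltonian a b H)
    (hW : IsFundamentalSolution a b H W) (z : ℂ) (hat : a ≤ t)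
    (htb : (t : EReal) < b)
    (hh2 : ¬ ∀ᵐ s ∂(volume.restrict (Set.Ioo a t)), H s 1 1 = 0) :
    0 < ∫ s in a..t, hermForm (H s) (W s z 1 0) (W s z 1 1) := by
  obtain ⟨p0, p1⟩ := hW.isPrimitiveOn hH z hat htb 1
  have hpsd := hH.ae_uIoc_posSemidef hat htb
  set φ : ℝ → ℝ := fun s => hermForm (H s) (W s z 1 0) (W s z 1 1) with hφ
  have hφ0 : 0 ≤ᵐ[volume.restrict (Ioc a t)] φ := by
    rw [← uIoc_of_le hat]
    refine (ae_restrict_iff' measurableSet_uIoc).2 ?_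
    filter_upwards [hpsd] with s hs hst
    exact hermForm_nonneg (hs hst) _ _
  have hφint : IntervalIntegrable φ volume a t := by
    have hc0 := p0.continuousOn
    have hc1 := p1.continuousOn
    have h := fun i j => hH.locInt i j t hat htb
    refine (((h 0 0).continuousOn_mul (Complex.continuous_normSq.comp_continuousOn hc0)).add
      ((h 1 1).continuousOn_mul (Complex.continuous_normSq.comp_continuousOn hc1))).add
      (((h 0 1).const_mul 2).mul_continuousOn
        (Complex.continuous_re.comp_continuousOn (hc0.mul hc1.star)))
  have hnonneg := intervalIntegral.integral_nonneg_of_ae_restrict hat (f := φ) (μ := volume) (by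
    rwa [restrict_Ioc_eq_restrict_Icc] at hφ0)
  refine lt_of_le_of_ne hnonneg fun h0 => hh2 ?_
  have hzero := (intervalIntegral.integral_eq_zero_iff_of_le_of_nonneg_ae hat hφ0 hφint).1 h0.symm
  rw [← uIoc_of_le hat, Filter.EventuallyEq, ae_restrict_iff' measurableSet_uIoc] at hzero
  have hW0 : ∀ s ∈ Icc a t, W s z 1 0 = 0 := by
    have h := p0.congr_ae (g := fun _ => 0) (by
      filter_upwards [hzero, hpsd] with s h1 h2 hst
      have h := (normSq_le_mul_hermForm (h2 hst) (W s z 1 0) (W s z 1 1)).2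
      have h3 : hermForm (H s) (W s z 1 0) (W s z 1 1) = 0 := h1 hst
      rw [h3, mul_zero] at h
      rw [Complex.normSq_eq_zero.1 (le_antisymm h (Complex.normSq_nonneg _)), mul_zero])
    intro s hs
    simpa [hW.apply_left hH.a_lt_b z] using h.eq_add s hs
  have hW1 : ∀ s ∈ Icc a t, W s z 1 1 = 1 := by
    have h := p1.congr_ae (g := fun _ => 0) (by
      filter_upwards [hzero, hpsd] with s h1 h2 hst
      have h := (normSq_le_mul_hermForm (h2 hst) (W s z 1 0) (W s z 1 1)).1
      have h3 : hermForm (H s) (W s z 1 0) (W s z 1 1) = 0 := h1 hst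
      rw [h3, mul_zero] at h
      rw [Complex.normSq_eq_zero.1 (le_antisymm h (Complex.normSq_nonneg _)), mul_zero])
    intro s hs
    simpa [hW.apply_left hH.a_lt_b z] using h.eq_add s hs
  rw [ae_restrict_iff' measurableSet_Ioo]
  filter_upwards [hzero] with s hs hst
  have hst' : s ∈ Icc a t := Ioo_subset_Icc_self hst
  have h : hermForm (H s) (W s z 1 0) (W s z 1 1) = 0 := hs (by
    rw [uIoc_of_le hat]
    exact Ioo_subset_Ioc_self hst)
  simpa [hermForm, hW0 s hst', hW1 s hst'] using h

end WeylDisc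

/-- Lemma 2.1: centre and radius of a Weyl disc. -/
theorem stmt4 (a : ℝ) (b : EReal) (H : ℝ → Matrix (Fin 2) (Fin 2) ℝ)
    (hH : IsHamiltonian a b H)
    (W : ℝ → ℂ → Matrix (Fin 2) (Fin 2) ℂ) (hW : IsFundamentalSolution a b H W)
    (z : ℂ) (hz : 0 < z.im)
    (t : ℝ) (hat : a < t) (htb : (t : EReal) < b)
    (hh2 : ¬ ∀ᵐ s ∂(volume.restrict (Set.Ioo a t)), H s 1 1 = 0) :
    0 < (nablaMat a H W t z 1 1).re ∧ (nablaMat a H W t z 1 1).im = 0 ∧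
    insert (W t z 0 0 / W t z 1 0)
        {w : ℂ | ∃ ζ : ℂ, 0 ≤ ζ.im ∧
          w = (W t z 0 0 * ζ + W t z 0 1) / (W t z 1 0 * ζ + W t z 1 1)} =
      Metric.closedBall
        (nablaMat a H W t z 0 1 / nablaMat a H W t z 1 1 +
          Complex.I / (2 * (z.im : ℂ) * nablaMat a H W t z 1 1))
        (1 / (2 * z.im * (nablaMat a H W t z 1 1).re)) := by
  have hat' := hat.le
  have hpos := hW.integral_hermForm_pos hH z hat' htb hh2
  have hA := hH.nablaMat_one_one W z hat' htb
  have hdet := hW.det_eq_one hH z hat' htb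
  have h11 := hW.mul_J_mul_conjTranspose hH z hat' htb 1 1
  have h01 := hW.mul_J_mul_conjTranspose hH z hat' htb 0 1
  set A := ∫ s in a..t, hermForm (H s) (W s z 1 0) (W s z 1 1)
  have c01 : JmatC 0 1 = -1 := rfl
  have c11 : JmatC 1 1 = 0 := rfl
  rw [c11] at h11
  rw [c01] at h01
  rw [hA] at h11 ⊢
  refine ⟨by simpa using hpos, by simp, ?_⟩
  have hA0 : (A : ℂ) ≠ 0 := by exact_mod_cast hpos.ne'
  have hy0 : (z.im : ℂ) ≠ 0 := by exact_mod_cast hz.ne'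
  have h := image_upperHalfPlane_eq_closedBall hdet (mul_pos hz hpos)
    (c := nablaMat a H W t z 0 1 / A + Complex.I / (2 * (z.im : ℂ) * A)) (by
      rw [h11]
      push_cast
      ring) (by
      rw [h01]
      push_cast
      field_simp
      linear_combination -Complex.I_sq)
  rwa [← mul_assoc, ← Complex.ofReal_re A] at h

end
end

section
/- Let H be a Hamiltonian on [a,b). Then for all t ∈ [a,b): |W_n(t)| ⪯ m⁺(t)^{n−1} · M⁺(t)·|J| for every n ≥ 1, and |α_{n,m}(t)| ⪯ m⁺(t)^{n+m} · M⁺(t) for all n, m ≥ 0. -/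
open MeasureTheory Filter Topology Matrix Set
open scoped ENNReal

noncomputable section

theorem entryAbsLe.mono {U V V' : Matrix (Fin 2) (Fin 2) ℝ} (h : entryAbsLe U V)
    (hV : ∀ i j, V i j ≤ V' i j) : entryAbsLe U V' :=
  fun i j => (h i j).trans (hV i j)

theorem entryAbsLe.mul {U U' V V' : Matrix (Fin 2) (Fin 2) ℝ} (hU : entryAbsLe U U')
    (hV : entryAbsLe V V') : entryAbsLe (U * V) (U' * V') := by
  intro i j
  simp only [Matrix.mul_apply]
  refine (Finset.abs_sum_le_sum_abs _ _).trans (Finset.sum_le_sum fun k _ => ?_)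
  rw [abs_mul]
  exact mul_le_mul (hU i k) (hV k j) (abs_nonneg _) ((abs_nonneg _).trans (hU i k))

theorem entryAbsLe.transpose {U V : Matrix (Fin 2) (Fin 2) ℝ} (h : entryAbsLe U V) :
    entryAbsLe Uᵀ Vᵀ :=
  fun i j => h j i

theorem entryAbsLe_one : entryAbsLe 1 1 := by
  intro i j
  fin_cases i <;> fin_cases j <;> simp

theorem entryAbsLe_neg_Jmat : entryAbsLe (-Jmat) Jabs := by
  intro i j
  fin_cases i <;> fin_cases j <;> simp [Jmat, Jabs]

theorem entryAbsLe.nonneg {U V : Matrix (Fin 2) (Fin 2) ℝ} (h : entryAbsLe U V) (i j : Fin 2) :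
    0 ≤ V i j :=
  (abs_nonneg _).trans (h i j)

theorem Matrix.mul_nonneg_entrywise {A B : Matrix (Fin 2) (Fin 2) ℝ}
    (hA : ∀ i j, 0 ≤ A i j) (hB : ∀ i j, 0 ≤ B i j) (i j : Fin 2) : 0 ≤ (A * B) i j := by
  rw [Matrix.mul_apply]
  exact Finset.sum_nonneg fun k _ => mul_nonneg (hA i k) (hB k j)

theorem Matrix.mul_le_mul_entrywise {A A' B B' : Matrix (Fin 2) (Fin 2) ℝ}
    (hA : ∀ i j, 0 ≤ A i j) (hB : ∀ i j, 0 ≤ B i j)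
    (hAA' : ∀ i j, A i j ≤ A' i j) (hBB' : ∀ i j, B i j ≤ B' i j) (i j : Fin 2) :
    (A * B) i j ≤ (A' * B') i j := by
  simp only [Matrix.mul_apply]
  exact Finset.sum_le_sum fun k _ =>
    mul_le_mul (hAA' i k) (hBB' k j) (hB k j) ((hA i k).trans (hAA' i k))

/-- The integral of a two-sided product `A * F s * B` with constant outer factors. -/
theorem intMat_const_mul_mul_const {F : ℝ → Matrix (Fin 2) (Fin 2) ℝ} {a t : ℝ}
    (hF : ∀ i j, IntervalIntegrable (fun s => F s i j) volume a t)
    (A B : Matrix (Fin 2) (Fin 2) ℝ) :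
    (∀ i j, IntervalIntegrable (fun s => (A * F s * B) i j) volume a t) ∧
      intMat (fun s => A * F s * B) a t = A * intMat F a t * B := by
  have hterm : ∀ i j k l,
      IntervalIntegrable (fun s => A i l * F s l k * B k j) volume a t :=
    fun i j k l => ((hF l k).const_mul _).mul_const _
  have hexp : ∀ s i j, (A * F s * B) i j = ∑ k, ∑ l, A i l * F s l k * B k j := by
    intro s i j
    simp only [Matrix.mul_apply, Finset.sum_mul]
  have hFint : ∀ i j k, IntervalIntegrable (fun s => ∑ l, A i l * F s l k * B k j) volume a t := by
    intro i j k
    simp only [Fin.sum_univ_two]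
    exact (hterm i j k 0).add (hterm i j k 1)
  refine ⟨fun i j => ?_, ?_⟩
  · simp only [hexp]
    simpa only [Fin.sum_univ_two] using (hFint i j 0).add (hFint i j 1)
  · ext i j
    change (∫ s in a..t, (A * F s * B) i j) = _
    simp only [hexp]
    rw [intervalIntegral.integral_finsetSum fun k _ => hFint i j k]
    simp only [Matrix.mul_apply, Finset.sum_mul]
    refine Finset.sum_congr rfl fun k _ => ?_
    rw [intervalIntegral.integral_finsetSum fun l _ => hterm i j k l]
    refine Finset.sum_congr rfl fun l _ => ?_
    rw [intervalIntegral.integral_mul_const, intervalIntegral.integral_const_mul]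
    rfl

/-- An entrywise bound under the integral gives an entrywise bound of the integral. -/
theorem entryAbsLe_intMat {F G : ℝ → Matrix (Fin 2) (Fin 2) ℝ} {a t : ℝ} (hat : a ≤ t)
    (hG : ∀ i j, IntervalIntegrable (fun s => G s i j) volume a t)
    (h : ∀ s ∈ Set.Ioc a t, entryAbsLe (F s) (G s)) :
    entryAbsLe (intMat F a t) (intMat G a t) := by
  intro i j
  change ‖∫ s in a..t, F s i j‖ ≤ ∫ s in a..t, G s i j
  exact intervalIntegral.norm_integral_le_of_norm_le hat
    (Filter.Eventually.of_forall fun s hs => h s hs i j) (hG i j)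

theorem Matrix.PosSemidef.quadratic_nonneg {A : Matrix (Fin 2) (Fin 2) ℝ} (hA : A.PosSemidef)
    (x : ℝ) : 0 ≤ A 0 0 * (x * x) + (-2 * |A 0 1|) * x + A 1 1 := by
  have h10 : A 1 0 = A 0 1 := by simpa using hA.1.apply 0 1
  have hdet := hA.det_nonneg
  rw [Matrix.det_fin_two, h10, ← abs_mul_abs_self (A 0 1)] at hdet
  have h0 : 0 ≤ A 0 0 := hA.diag_nonneg
  have h1 : 0 ≤ A 1 1 := hA.diag_nonneg
  rcases h0.eq_or_lt with h | h
  · rw [← h] at hdet ⊢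
    have : |A 0 1| = 0 := by nlinarith [mul_self_nonneg |A 0 1|]
    simpa [this] using h1
  · refine nonneg_of_mul_nonneg_right ?_ h
    nlinarith [sq_nonneg (A 0 0 * x - |A 0 1|)]

namespace IsHamiltonian

variable {a : ℝ} {b : EReal} {H : ℝ → Matrix (Fin 2) (Fin 2) ℝ}

theorem ae_restrict_posSemidef (hH : IsHamiltonian a b H) {t : ℝ} (htb : (t : EReal) < b) :
    ∀ᵐ s ∂(volume.restrict (Set.Icc a t)), (H s).PosSemidef := by
  rw [ae_restrict_iff' measurableSet_Icc]
  filter_upwards [hH.posSemidef] with s hs hst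
  exact hs hst.1 ((EReal.coe_le_coe_iff.2 hst.2).trans_lt htb)

theorem integral_diag_nonneg (hH : IsHamiltonian a b H) {t : ℝ} (hat : a ≤ t)
    (htb : (t : EReal) < b) (i : Fin 2) : 0 ≤ ∫ s in a..t, H s i i :=
  intervalIntegral.integral_nonneg_of_ae_restrict hat <|
    (hH.ae_restrict_posSemidef htb).mono fun _ hs => hs.diag_nonneg

theorem integral_diag_mono (hH : IsHamiltonian a b H) {s t : ℝ} (has : a ≤ s) (hst : s ≤ t)
    (htb : (t : EReal) < b) (i : Fin 2) :
    ∫ u in a..s, H u i i ≤ ∫ u in a..t, H u i i :=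
  intervalIntegral.integral_mono_interval le_rfl has hst
    ((ae_restrict_of_ae_restrict_of_subset Set.Ioc_subset_Icc_self
      (hH.ae_restrict_posSemidef htb)).mono fun _ hs => hs.diag_nonneg)
    (hH.locInt i i t (has.trans hst) htb)

/-- The Cauchy-Schwarz inequality for the off-diagonal entry of a Hamiltonian. -/
theorem integral_abs_offDiag_le (hH : IsHamiltonian a b H) {t : ℝ} (hat : a ≤ t)
    (htb : (t : EReal) < b) :
    ∫ s in a..t, |H s 0 1| ≤ √(m1 a H t * m2 a H t) := by
  have h0 := hH.locInt 0 0 t hat htb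
  have h1 := hH.locInt 1 1 t hat htb
  have h3 := (hH.locInt 0 1 t hat htb).abs
  have key : ∀ x : ℝ, 0 ≤ m1 a H t * (x * x) +
      (-2 * ∫ s in a..t, |H s 0 1|) * x + m2 a H t := by
    intro x
    have hnonneg : 0 ≤ ∫ s in a..t, (H s 0 0 * (x * x) + (-2 * |H s 0 1|) * x + H s 1 1) :=
      intervalIntegral.integral_nonneg_of_ae_restrict hat <|
        (hH.ae_restrict_posSemidef htb).mono fun s hs => hs.quadratic_nonneg x
    rwa [intervalIntegral.integral_add ((h0.mul_const _).add ((h3.const_mul _).mul_const _)) h1,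
      intervalIntegral.integral_add (h0.mul_const _) ((h3.const_mul _).mul_const _),
      intervalIntegral.integral_mul_const, intervalIntegral.integral_mul_const,
      intervalIntegral.integral_const_mul] at hnonneg
  have hdiscr := discrim_le_zero key
  rw [discrim] at hdiscr
  apply Real.le_sqrt_of_sq_le
  linarith

theorem intMat_abs_le_MplusMat (hH : IsHamiltonian a b H) {t : ℝ} (hat : a ≤ t)
    (htb : (t : EReal) < b) (i j : Fin 2) :
    intMat (fun s => (H s).map abs) a t i j ≤ MplusMat a H t i j := by
  have hae : ∀ᵐ s, s ∈ Set.uIoc a t → (H s).PosSemidef := by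
    rw [Set.uIoc_of_le hat]
    exact (ae_restrict_iff' measurableSet_Ioc).1
      (ae_restrict_of_ae_restrict_of_subset Set.Ioc_subset_Icc_self
        (hH.ae_restrict_posSemidef htb))
  have hdiag : ∀ k, ∫ s in a..t, |H s k k| = ∫ s in a..t, H s k k := fun k =>
    intervalIntegral.integral_congr_ae (hae.mono fun s hs h => abs_of_nonneg (hs h).diag_nonneg)
  have hsymm : ∫ s in a..t, |H s 1 0| = ∫ s in a..t, |H s 0 1| :=
    intervalIntegral.integral_congr_ae
      (hae.mono fun s hs h => congrArg abs (by simpa using (hs h).1.apply 0 1))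
  have hoff := hH.integral_abs_offDiag_le hat htb
  fin_cases i <;> fin_cases j
  · exact (hdiag 0).le
  · exact hoff
  · exact hsymm.trans_le hoff
  · exact (hdiag 1).le

theorem MplusMat_nonneg (hH : IsHamiltonian a b H) {t : ℝ} (hat : a ≤ t)
    (htb : (t : EReal) < b) (i j : Fin 2) : 0 ≤ MplusMat a H t i j := by
  fin_cases i <;> fin_cases j
  · exact hH.integral_diag_nonneg hat htb 0
  · exact Real.sqrt_nonneg _
  · exact Real.sqrt_nonneg _
  · exact hH.integral_diag_nonneg hat htb 1

theorem sqrt_mul_mono (hH : IsHamiltonian a b H) {s t : ℝ} (has : a ≤ s) (hst : s ≤ t)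
    (htb : (t : EReal) < b) :
    √(m1 a H s * m2 a H s) ≤ √(m1 a H t * m2 a H t) :=
  Real.sqrt_le_sqrt <| mul_le_mul (hH.integral_diag_mono has hst htb 0)
    (hH.integral_diag_mono has hst htb 1)
    (hH.integral_diag_nonneg has ((EReal.coe_le_coe_iff.2 hst).trans_lt htb) 1)
    (hH.integral_diag_nonneg (has.trans hst) htb 0)

theorem MplusMat_mono (hH : IsHamiltonian a b H) {s t : ℝ} (has : a ≤ s) (hst : s ≤ t)
    (htb : (t : EReal) < b) (i j : Fin 2) : MplusMat a H s i j ≤ MplusMat a H t i j := by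
  fin_cases i <;> fin_cases j
  · exact hH.integral_diag_mono has hst htb 0
  · exact hH.sqrt_mul_mono has hst htb
  · exact hH.sqrt_mul_mono has hst htb
  · exact hH.integral_diag_mono has hst htb 1

theorem MplusMat_mul_Jabs_mul_MplusMat (hH : IsHamiltonian a b H) {t : ℝ} (hat : a ≤ t)
    (htb : (t : EReal) < b) :
    MplusMat a H t * Jabs * MplusMat a H t = mplus a H t • MplusMat a H t := by
  have hsq : √(m1 a H t * m2 a H t) * √(m1 a H t * m2 a H t) = m1 a H t * m2 a H t :=
    Real.mul_self_sqrt
      (mul_nonneg (hH.integral_diag_nonneg hat htb 0) (hH.integral_diag_nonneg hat htb 1))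
  ext i j
  fin_cases i <;> fin_cases j <;>
    simp [MplusMat, Jabs, mplus, Matrix.mul_apply, Fin.sum_univ_two] <;> linarith

/-- If `U` and `V` are bounded on `(a, t]` by constant matrices, so is `∫ U H Vᵀ`. -/
theorem entryAbsLe_intMat_mul_mul (hH : IsHamiltonian a b H) {t : ℝ} (hat : a ≤ t)
    (htb : (t : EReal) < b) {U V : ℝ → Matrix (Fin 2) (Fin 2) ℝ}
    {A B : Matrix (Fin 2) (Fin 2) ℝ} (hA : ∀ i j, 0 ≤ A i j) (hB : ∀ i j, 0 ≤ B i j)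
    (hU : ∀ s ∈ Set.Ioc a t, entryAbsLe (U s) A) (hV : ∀ s ∈ Set.Ioc a t, entryAbsLe (V s) B) :
    entryAbsLe (intMat (fun s => U s * H s * (V s)ᵀ) a t) (A * MplusMat a H t * Bᵀ) := by
  have habs : ∀ i j, IntervalIntegrable (fun s => (H s).map abs i j) volume a t :=
    fun i j => (hH.locInt i j t hat htb).abs
  obtain ⟨hFint, heq⟩ := intMat_const_mul_mul_const habs A Bᵀ
  have hle := entryAbsLe_intMat hat hFint fun s hs =>
    ((hU s hs).mul (V := H s) fun _ _ => le_rfl).mul (hV s hs).transpose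
  rw [heq] at hle
  have hnonneg : ∀ i j, 0 ≤ intMat (fun s => (H s).map abs) a t i j := fun i j =>
    intervalIntegral.integral_nonneg_of_forall hat fun s => abs_nonneg (H s i j)
  refine hle.mono (Matrix.mul_le_mul_entrywise ?_ (fun i j => hB j i) ?_ fun _ _ => le_rfl)
  · exact Matrix.mul_nonneg_entrywise hA hnonneg
  · exact Matrix.mul_le_mul_entrywise hA hnonneg (fun _ _ => le_rfl)
      (hH.intMat_abs_le_MplusMat hat htb)

end IsHamiltonian

/-- The majorant of the `n`-th power series coefficient of the fundamental solution. -/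
def coeffMajorant (a : ℝ) (H : ℝ → Matrix (Fin 2) (Fin 2) ℝ) :
    ℕ → ℝ → Matrix (Fin 2) (Fin 2) ℝ
  | 0, _ => 1
  | n + 1, t => mplus a H t ^ n • (MplusMat a H t * Jabs)

namespace IsHamiltonian

variable {a : ℝ} {b : EReal} {H : ℝ → Matrix (Fin 2) (Fin 2) ℝ}

theorem coeffMajorant_mul_MplusMat (hH : IsHamiltonian a b H) {t : ℝ} (hat : a ≤ t)
    (htb : (t : EReal) < b) (n : ℕ) :
    coeffMajorant a H n t * MplusMat a H t = mplus a H t ^ n • MplusMat a H t := by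
  cases n with
  | zero => simp [coeffMajorant]
  | succ n =>
    rw [coeffMajorant, Matrix.smul_mul, hH.MplusMat_mul_Jabs_mul_MplusMat hat htb, smul_smul,
      pow_succ]

theorem MplusMat_mul_coeffMajorant_transpose (hH : IsHamiltonian a b H) {t : ℝ} (hat : a ≤ t)
    (htb : (t : EReal) < b) (n : ℕ) :
    MplusMat a H t * (coeffMajorant a H n t)ᵀ = mplus a H t ^ n • MplusMat a H t := by
  have hM : (MplusMat a H t)ᵀ = MplusMat a H t := by
    ext i j
    fin_cases i <;> fin_cases j <;> rfl
  have h := congrArg Matrix.transpose (hH.coeffMajorant_mul_MplusMat hat htb n)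
  rwa [Matrix.transpose_mul, Matrix.transpose_smul, hM] at h

theorem coeffMajorant_nonneg (hH : IsHamiltonian a b H) {t : ℝ} (hat : a ≤ t)
    (htb : (t : EReal) < b) (n : ℕ) (i j : Fin 2) : 0 ≤ coeffMajorant a H n t i j := by
  cases n with
  | zero => exact entryAbsLe_one.nonneg i j
  | succ n =>
    refine mul_nonneg (pow_nonneg (mul_nonneg zero_le_two (Real.sqrt_nonneg _)) n) ?_
    exact Matrix.mul_nonneg_entrywise (hH.MplusMat_nonneg hat htb) entryAbsLe_neg_Jmat.nonneg i j

theorem coeffMajorant_mono (hH : IsHamiltonian a b H) {s t : ℝ} (has : a ≤ s) (hst : s ≤ t)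
    (htb : (t : EReal) < b) (n : ℕ) (i j : Fin 2) :
    coeffMajorant a H n s i j ≤ coeffMajorant a H n t i j := by
  cases n with
  | zero => exact le_rfl
  | succ n =>
    have hsb : (s : EReal) < b := (EReal.coe_le_coe_iff.2 hst).trans_lt htb
    have hs : 0 ≤ mplus a H s := mul_nonneg zero_le_two (Real.sqrt_nonneg _)
    have hm : mplus a H s ≤ mplus a H t :=
      mul_le_mul_of_nonneg_left (hH.sqrt_mul_mono has hst htb) zero_le_two
    refine mul_le_mul (pow_le_pow_left₀ hs hm n) ?_ ?_ (pow_nonneg (hs.trans hm) n)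
    · exact Matrix.mul_le_mul_entrywise (hH.MplusMat_nonneg has hsb) entryAbsLe_neg_Jmat.nonneg
        (hH.MplusMat_mono has hst htb) (fun _ _ => le_rfl) i j
    · exact Matrix.mul_nonneg_entrywise (hH.MplusMat_nonneg has hsb) entryAbsLe_neg_Jmat.nonneg i j

theorem entryAbsLe_coeffMajorant (hH : IsHamiltonian a b H)
    {W : ℕ → ℝ → Matrix (Fin 2) (Fin 2) ℝ} (hW : IsCoeffSeq a H W) (n : ℕ) :
    ∀ t : ℝ, a ≤ t → (t : EReal) < b → entryAbsLe (W n t) (coeffMajorant a H n t) := by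
  induction n with
  | zero =>
    intro t _ _
    rw [hW.1 t]
    exact entryAbsLe_one
  | succ n ih =>
    intro t hat htb
    have h := hH.entryAbsLe_intMat_mul_mul hat htb (hH.coeffMajorant_nonneg hat htb n)
      entryAbsLe_one.nonneg
      (fun s hs => (ih s hs.1.le ((EReal.coe_le_coe_iff.2 hs.2).trans_lt htb)).mono
        (hH.coeffMajorant_mono hs.1.le hs.2 htb n))
      (V := fun _ => 1) (fun _ _ => entryAbsLe_one)
    simp only [Matrix.transpose_one, Matrix.mul_one] at h
    rw [hH.coeffMajorant_mul_MplusMat hat htb] at h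
    rw [hW.2 n t, coeffMajorant, ← Matrix.smul_mul]
    exact h.mul entryAbsLe_neg_Jmat

end IsHamiltonian

/-- Lemma 3.2: coefficient estimates for the power series of the fundamental solution. -/
theorem stmt5 (a : ℝ) (b : EReal) (H : ℝ → Matrix (Fin 2) (Fin 2) ℝ)
    (hH : IsHamiltonian a b H)
    (W : ℕ → ℝ → Matrix (Fin 2) (Fin 2) ℝ) (hW : IsCoeffSeq a H W) :
    ∀ t : ℝ, a ≤ t → (t : EReal) < b →
      (∀ n : ℕ, 1 ≤ n →
        entryAbsLe (W n t) (mplus a H t ^ (n - 1) • (MplusMat a H t * Jabs))) ∧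
      (∀ n m : ℕ,
        entryAbsLe (alphaMat a H W n m t) (mplus a H t ^ (n + m) • MplusMat a H t)) := by
  intro t hat htb
  refine ⟨fun n hn => ?_, fun n m => ?_⟩
  · obtain ⟨n, rfl⟩ := Nat.exists_eq_succ_of_ne_zero (Nat.one_le_iff_ne_zero.1 hn)
    exact hH.entryAbsLe_coeffMajorant hW (n + 1) t hat htb
  · have hbound : ∀ k, ∀ s ∈ Set.Ioc a t, entryAbsLe (W k s) (coeffMajorant a H k t) :=
      fun k s hs =>
        (hH.entryAbsLe_coeffMajorant hW k s hs.1.le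
          ((EReal.coe_le_coe_iff.2 hs.2).trans_lt htb)).mono
          (hH.coeffMajorant_mono hs.1.le hs.2 htb k)
    have h := hH.entryAbsLe_intMat_mul_mul hat htb (hH.coeffMajorant_nonneg hat htb n)
      (hH.coeffMajorant_nonneg hat htb m) (hbound n) (hbound m)
    rwa [hH.coeffMajorant_mul_MplusMat hat htb, Matrix.smul_mul,
      hH.MplusMat_mul_coeffMajorant_transpose hat htb, smul_smul, ← pow_add] at h

end
end

section
/- Let H be a Hamiltonian on [a,b). Then for all t ∈ [a,b): (1) for all n, m ≥ 1, ∫_a^t W_n(s)H(s)W_m(s)* ds = W_n(t)W_1(t)J W_m(t)* + ∫_a^t W_n(s)W_1(s)H(s)W_{m−1}(s)* ds + ∫_a^t W_{n−1}(s)H(s)W_1(s)* W_m(s)* ds; and (2) for all n ≥ 3, W_n(t) = W_{n−1}(t)W_1(t) + (det M(t))·W_{n−2}(t) + ∫_a^t (det M(s))·W_{n−3}(s)H(s)J ds − ∫_a^t W_{n−2}(s) J W_1(s)* · J H(s) J ds. -/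
open MeasureTheory Filter Topology Matrix Set
open scoped ENNReal

noncomputable section

/-- Entrywise interval integrability of a matrix-valued function. -/
def MatIntegrable (f : ℝ → Matrix (Fin 2) (Fin 2) ℝ) (a t : ℝ) : Prop :=
  ∀ i j, IntervalIntegrable (fun s => f s i j) volume a t

/-- `F` is entrywise absolutely continuous on `[a, t]` with a.e. derivative `F'`. -/
structure MatPrimitive (F F' : ℝ → Matrix (Fin 2) (Fin 2) ℝ) (a t : ℝ) : Prop where
  ac : ∀ i j, AbsolutelyContinuousOnInterval (fun s => F s i j) a t
  hasDerivAt : ∀ᵐ s, s ∈ uIcc a t → ∀ i j, HasDerivAt (fun s => F s i j) (F' s i j) s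

namespace MatPrimitive

variable {F F' G G' f : ℝ → Matrix (Fin 2) (Fin 2) ℝ} {a t : ℝ}

theorem const (A : Matrix (Fin 2) (Fin 2) ℝ) (a t : ℝ) :
    MatPrimitive (fun _ => A) (fun _ => 0) a t where
  ac i j := ((LipschitzWith.const (A i j)).lipschitzOnWith).absolutelyContinuousOnInterval
  hasDerivAt := .of_forall fun s _ i j => hasDerivAt_const s (A i j)

theorem add (hF : MatPrimitive F F' a t) (hG : MatPrimitive G G' a t) :
    MatPrimitive (fun s => F s + G s) (fun s => F' s + G' s) a t where
  ac i j := (hF.ac i j).add (hG.ac i j)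
  hasDerivAt := by
    filter_upwards [hF.hasDerivAt, hG.hasDerivAt] with s hs hs' hst i j
    exact (hs hst i j).add (hs' hst i j)

theorem sub (hF : MatPrimitive F F' a t) (hG : MatPrimitive G G' a t) :
    MatPrimitive (fun s => F s - G s) (fun s => F' s - G' s) a t where
  ac i j := (hF.ac i j).sub (hG.ac i j)
  hasDerivAt := by
    filter_upwards [hF.hasDerivAt, hG.hasDerivAt] with s hs hs' hst i j
    exact (hs hst i j).sub (hs' hst i j)

theorem mul (hF : MatPrimitive F F' a t) (hG : MatPrimitive G G' a t) :
    MatPrimitive (fun s => F s * G s) (fun s => F' s * G s + F s * G' s) a t where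
  ac i j := by
    simp only [Matrix.mul_apply, Fin.sum_univ_two]
    exact ((hF.ac i 0).mul (hG.ac 0 j)).add ((hF.ac i 1).mul (hG.ac 1 j))
  hasDerivAt := by
    filter_upwards [hF.hasDerivAt, hG.hasDerivAt] with s hs hs' hst i j
    simp only [Matrix.add_apply, Matrix.mul_apply, Fin.sum_univ_two]
    refine (((hs hst i 0).mul (hs' hst 0 j)).add
      ((hs hst i 1).mul (hs' hst 1 j))).congr_deriv ?_
    ring

theorem mul_const (hF : MatPrimitive F F' a t) (A : Matrix (Fin 2) (Fin 2) ℝ) :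
    MatPrimitive (fun s => F s * A) (fun s => F' s * A) a t := by
  simpa using hF.mul (const A a t)

theorem transpose (hF : MatPrimitive F F' a t) :
    MatPrimitive (fun s => (F s)ᵀ) (fun s => (F' s)ᵀ) a t where
  ac i j := hF.ac j i
  hasDerivAt := by
    filter_upwards [hF.hasDerivAt] with s hs hst i j using hs hst j i

theorem congr_deriv (hF : MatPrimitive F F' a t) (h : ∀ᵐ s, s ∈ uIcc a t → F' s = G' s) :
    MatPrimitive F G' a t where
  ac := hF.ac
  hasDerivAt := by
    filter_upwards [hF.hasDerivAt, h] with s hs hs' hst i j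
    exact hs' hst ▸ hs hst i j

theorem intMat (hf : MatIntegrable f a t) : MatPrimitive (intMat f a) f a t where
  ac i j := (hf i j).absolutelyContinuousOnInterval_intervalIntegral left_mem_uIcc
  hasDerivAt := by
    have h : ∀ᵐ s, ∀ i j, s ∈ uIcc a t → ∀ c ∈ uIcc a t,
        HasDerivAt (fun x => ∫ v in c..x, f v i j) (f s i j) s :=
      ae_all_iff.2 fun i => ae_all_iff.2 fun j => (hf i j).ae_hasDerivAt_integral
    filter_upwards [h] with s hs hst i j using hs i j hst a left_mem_uIcc

theorem eq_of_ae_deriv_eq_zero (hF : MatPrimitive F F' a t)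
    (h : ∀ᵐ s, s ∈ uIcc a t → F' s = 0) : F t = F a := by
  ext i j
  obtain ⟨C, hC⟩ := (hF.ac i j).const_of_ae_hasDerivAt_zero (by
    filter_upwards [hF.hasDerivAt, h] with s hs hs' hst
    simpa [hs' hst] using hs hst i j)
  rw [hC t right_mem_uIcc, hC a left_mem_uIcc]

theorem matIntegrable_mul_left (hF : MatPrimitive F F' a t) (hf : MatIntegrable f a t) :
    MatIntegrable (fun s => F s * f s) a t := fun i j => by
  simp only [Matrix.mul_apply, Fin.sum_univ_two]
  exact ((hf 0 j).continuousOn_mul (hF.ac i 0).continuousOn).add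
    ((hf 1 j).continuousOn_mul (hF.ac i 1).continuousOn)

theorem matIntegrable_mul_right (hF : MatPrimitive F F' a t) (hf : MatIntegrable f a t) :
    MatIntegrable (fun s => f s * F s) a t := fun i j => by
  simp only [Matrix.mul_apply, Fin.sum_univ_two]
  exact ((hf i 0).mul_continuousOn (hF.ac 0 j).continuousOn).add
    ((hf i 1).mul_continuousOn (hF.ac 1 j).continuousOn)

end MatPrimitive

theorem intMat_self (f : ℝ → Matrix (Fin 2) (Fin 2) ℝ) (a : ℝ) : intMat f a a = 0 := by
  ext i j; simp [intMat]

theorem Jmat_mul_self : Jmat * Jmat = -1 := by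
  ext i j; fin_cases i <;> fin_cases j <;> simp [Jmat]

theorem Jmat_transpose : Jmatᵀ = -Jmat := by
  ext i j; fin_cases i <;> fin_cases j <;> simp [Jmat]

theorem Mmat_transpose (a : ℝ) (H : ℝ → Matrix (Fin 2) (Fin 2) ℝ) (s : ℝ) :
    (Mmat a H s)ᵀ = Mmat a H s := by
  ext i j; fin_cases i <;> fin_cases j <;> simp [Mmat]

/-- For symmetric `M`, `(det M) I = -(M J)²`. -/
theorem det_smul_eq_mul_Jmat {M : Matrix (Fin 2) (Fin 2) ℝ} (hM : Mᵀ = M)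
    (X : Matrix (Fin 2) (Fin 2) ℝ) : M.det • X = X * (M * -Jmat * (M * Jmat)) := by
  have h : M 1 0 = M 0 1 := congrFun (congrFun hM 0) 1
  have hdet : M * -Jmat * (M * Jmat) = M.det • 1 := by
    ext i j
    fin_cases i <;> fin_cases j <;>
      simp [Jmat, Matrix.mul_apply, Fin.sum_univ_two, Matrix.det_fin_two, h] <;> ring
  rw [hdet, mul_smul_comm, mul_one]

section Coefficients

variable {a t : ℝ} {b : EReal} {H : ℝ → Matrix (Fin 2) (Fin 2) ℝ}
  {W : ℕ → ℝ → Matrix (Fin 2) (Fin 2) ℝ}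

theorem IsHamiltonian.ae_transpose_eq (hH : IsHamiltonian a b H) (hat : a ≤ t)
    (htb : (t : EReal) < b) : ∀ᵐ s, s ∈ uIcc a t → (H s)ᵀ = H s := by
  filter_upwards [hH.posSemidef] with s hs hst
  rw [uIcc_of_le hat] at hst
  simpa using (hs hst.1 ((EReal.coe_le_coe hst.2).trans_lt htb)).isHermitian.eq

theorem IsHamiltonian.matIntegrable (hH : IsHamiltonian a b H) (hat : a ≤ t)
    (htb : (t : EReal) < b) : MatIntegrable H a t :=
  fun i j => hH.locInt i j t hat htb

theorem IsHamiltonian.intMat_eq_Mmat (hH : IsHamiltonian a b H) (hat : a ≤ t)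
    (htb : (t : EReal) < b) : intMat H a t = Mmat a H t := by
  have h : ∫ s in a..t, H s 1 0 = ∫ s in a..t, H s 0 1 := by
    apply intervalIntegral.integral_congr_ae
    filter_upwards [hH.ae_transpose_eq hat htb] with s hs hst
    exact congrFun (congrFun (hs (uIoc_subset_uIcc hst)) 0) 1
  ext i j
  fin_cases i <;> fin_cases j <;> simp [intMat, Mmat, m1, m2, m3, h]

theorem IsHamiltonian.matPrimitive_Mmat (hH : IsHamiltonian a b H) (hat : a ≤ t)
    (htb : (t : EReal) < b) : MatPrimitive (Mmat a H) H a t := by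
  have hI := hH.matIntegrable hat htb
  let K : ℝ → Matrix (Fin 2) (Fin 2) ℝ := fun s => !![H s 0 0, H s 0 1; H s 0 1, H s 1 1]
  have hK : MatIntegrable K a t := by
    intro i j
    fin_cases i <;> fin_cases j
    exacts [hI 0 0, hI 0 1, hI 0 1, hI 1 1]
  have hM : Mmat a H = intMat K a := by
    ext s i j
    fin_cases i <;> fin_cases j <;> simp [intMat, Mmat, m1, m2, m3, K]
  rw [hM]
  refine (MatPrimitive.intMat hK).congr_deriv ?_
  filter_upwards [hH.ae_transpose_eq hat htb] with s hs hst
  have h : H s 1 0 = H s 0 1 := congrFun (congrFun (hs hst) 0) 1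
  ext i j
  fin_cases i <;> fin_cases j <;> simp [K, h]

theorem IsCoeffSeq.succ_eq (hW : IsCoeffSeq a H W) (n : ℕ) (s : ℝ) :
    W (n + 1) s = intMat (fun s => W n s * H s) a s * -Jmat :=
  hW.2 n s

theorem IsCoeffSeq.succ_self (hW : IsCoeffSeq a H W) (n : ℕ) : W (n + 1) a = 0 := by
  rw [hW.succ_eq, intMat_self, zero_mul]

theorem IsCoeffSeq.one_eq (hW : IsCoeffSeq a H W) (hH : IsHamiltonian a b H) (hat : a ≤ t)
    (htb : (t : EReal) < b) : W 1 t = Mmat a H t * -Jmat := by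
  rw [hW.succ_eq 0]
  simp only [hW.1, one_mul, hH.intMat_eq_Mmat hat htb]

theorem IsCoeffSeq.exists_matPrimitive (hW : IsCoeffSeq a H W) (hH : MatIntegrable H a t)
    (n : ℕ) : ∃ V, MatPrimitive (W n) V a t := by
  induction n with
  | zero =>
    have h : W 0 = fun _ => 1 := funext hW.1
    exact ⟨_, h ▸ MatPrimitive.const 1 a t⟩
  | succ n ih =>
    obtain ⟨V, hV⟩ := ih
    rw [funext (hW.succ_eq n)]
    exact ⟨_, (MatPrimitive.intMat (hV.matIntegrable_mul_left hH)).mul_const _⟩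

theorem IsCoeffSeq.matPrimitive_succ (hW : IsCoeffSeq a H W) (hH : MatIntegrable H a t)
    (n : ℕ) : MatPrimitive (W (n + 1)) (fun s => W n s * H s * -Jmat) a t := by
  obtain ⟨V, hV⟩ := hW.exists_matPrimitive hH n
  rw [funext (hW.succ_eq n)]
  exact (MatPrimitive.intMat (hV.matIntegrable_mul_left hH)).mul_const _

theorem IsCoeffSeq.intMat_mul_transpose (hW : IsCoeffSeq a H W) (hH : IsHamiltonian a b H)
    (hat : a ≤ t) (htb : (t : EReal) < b) (n m : ℕ) :
    intMat (fun s => W (n + 1) s * H s * (W (m + 1) s)ᵀ) a t =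
      W (n + 1) t * W 1 t * Jmat * (W (m + 1) t)ᵀ +
      intMat (fun s => W (n + 1) s * W 1 s * H s * (W m s)ᵀ) a t +
      intMat (fun s => W n s * H s * (W 1 s)ᵀ * (W (m + 1) s)ᵀ) a t := by
  have hI := hH.matIntegrable hat htb
  have h1 := hW.matPrimitive_succ hI 0
  have hn := hW.matPrimitive_succ hI n
  have hm := hW.matPrimitive_succ hI m
  obtain ⟨_, hn'⟩ := hW.exists_matPrimitive hI n
  obtain ⟨_, hm'⟩ := hW.exists_matPrimitive hI m
  have hα := MatPrimitive.intMat
    (hm.transpose.matIntegrable_mul_right (hn.matIntegrable_mul_left hI))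
  have hβ := MatPrimitive.intMat
    (hm'.transpose.matIntegrable_mul_right ((hn.mul h1).matIntegrable_mul_left hI))
  have hγ := MatPrimitive.intMat (hm.transpose.matIntegrable_mul_right
    (h1.transpose.matIntegrable_mul_right (hn'.matIntegrable_mul_left hI)))
  have key := (((((hn.mul h1).mul_const Jmat).mul hm.transpose).add hβ).add hγ).sub hα
    |>.eq_of_ae_deriv_eq_zero (by
      filter_upwards [hH.ae_transpose_eq hat htb] with s hs hst
      have hs := hs hst
      rw [uIcc_of_le hat] at hst
      have e := hW.one_eq hH hst.1 ((EReal.coe_le_coe hst.2).trans_lt htb)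
      have hM := Mmat_transpose a H s
      generalize Mmat a H s = M at e hM
      simp only [zero_add, e, hW.1, Matrix.transpose_mul, Matrix.transpose_neg, Jmat_transpose,
        hM, hs, one_mul, mul_neg, neg_mul, neg_neg, mul_assoc, add_mul, Jmat_mul_self, mul_one]
      abel)
  simp only [hW.succ_self, intMat_self, zero_mul, add_zero, sub_zero, sub_eq_zero] at key
  exact key.symm

theorem IsCoeffSeq.add_three_eq (hW : IsCoeffSeq a H W) (hH : IsHamiltonian a b H)
    (hat : a ≤ t) (htb : (t : EReal) < b) (n : ℕ) :
    W (n + 3) t =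
      W (n + 2) t * W 1 t + (Mmat a H t).det • W (n + 1) t +
      intMat (fun s => (Mmat a H s).det • (W n s * H s * Jmat)) a t -
      intMat (fun s => W (n + 1) s * Jmat * (W 1 s)ᵀ * (Jmat * H s * Jmat)) a t := by
  have hI := hH.matIntegrable hat htb
  have hJ := MatPrimitive.const Jmat a t
  have hM := hH.matPrimitive_Mmat hat htb
  have h1 := hW.matPrimitive_succ hI 0
  have hn1 := hW.matPrimitive_succ hI n
  have hn2 := hW.matPrimitive_succ hI (n + 1)
  have hn3 := hW.matPrimitive_succ hI (n + 2)
  obtain ⟨_, hn⟩ := hW.exists_matPrimitive hI n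
  have hdet := (hM.mul_const (-Jmat)).mul (hM.mul_const Jmat)
  have hA := MatPrimitive.intMat (hdet.matIntegrable_mul_right
    (hJ.matIntegrable_mul_right (hn.matIntegrable_mul_left hI)))
  have hB := MatPrimitive.intMat (((hn1.mul hJ).mul h1.transpose).matIntegrable_mul_left
    (hJ.matIntegrable_mul_right (hJ.matIntegrable_mul_left hI)))
  simp only [det_smul_eq_mul_Jmat (Mmat_transpose a H _)]
  have key := ((((hn2.mul h1).add (hn1.mul hdet)).add hA).sub hB).sub hn3
    |>.eq_of_ae_deriv_eq_zero (by
      refine .of_forall fun s hst => ?_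
      rw [uIcc_of_le hat] at hst
      have e := hW.one_eq hH hst.1 ((EReal.coe_le_coe hst.2).trans_lt htb)
      have hM := Mmat_transpose a H s
      generalize Mmat a H s = M at e hM
      have hJ (X : Matrix (Fin 2) (Fin 2) ℝ) : Jmat * (Jmat * X) = -X := by
        rw [← mul_assoc, Jmat_mul_self, neg_one_mul]
      simp only [zero_add, e, hW.1, Matrix.transpose_mul, Matrix.transpose_neg, Jmat_transpose,
        hM, one_mul, mul_neg, neg_mul, neg_neg, mul_assoc, mul_add, hJ]
      abel)
  simp only [hW.succ_self, intMat_self, zero_mul, add_zero, sub_zero, sub_eq_zero] at key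
  exact key.symm

end Coefficients

/-- Lemma 3.3: integration-by-parts identities for the coefficients. -/
theorem stmt6 (a : ℝ) (b : EReal) (H : ℝ → Matrix (Fin 2) (Fin 2) ℝ)
    (hH : IsHamiltonian a b H)
    (W : ℕ → ℝ → Matrix (Fin 2) (Fin 2) ℝ) (hW : IsCoeffSeq a H W) :
    ∀ t : ℝ, a ≤ t → (t : EReal) < b →
      (∀ n m : ℕ, 1 ≤ n → 1 ≤ m →
        intMat (fun s => W n s * H s * (W m s)ᵀ) a t =
          W n t * W 1 t * Jmat * (W m t)ᵀ +
          intMat (fun s => W n s * W 1 s * H s * (W (m - 1) s)ᵀ) a t +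
          intMat (fun s => W (n - 1) s * H s * (W 1 s)ᵀ * (W m s)ᵀ) a t) ∧
      (∀ n : ℕ, 3 ≤ n →
        W n t =
          W (n - 1) t * W 1 t + (Mmat a H t).det • W (n - 2) t +
          intMat (fun s => (Mmat a H s).det • (W (n - 3) s * H s * Jmat)) a t -
          intMat (fun s => W (n - 2) s * Jmat * (W 1 s)ᵀ * (Jmat * H s * Jmat)) a t) := by
  intro t hat htb
  refine ⟨fun n m hn hm => ?_, fun n hn => ?_⟩
  · obtain ⟨n, rfl⟩ := Nat.exists_eq_add_of_le' hn
    obtain ⟨m, rfl⟩ := Nat.exists_eq_add_of_le' hm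
    exact hW.intMat_mul_transpose hH hat htb n m
  · obtain ⟨n, rfl⟩ := Nat.exists_eq_add_of_le' hn
    exact hW.add_three_eq hH hat htb n

end
end

section
/- Let H be a Hamiltonian on [a,b) and set β_{n,m}(t) = W_n(t) J W_m(t)*. Then for all integers k, l ≥ 0 with (k,l) ≠ (0,0) and all t ∈ [a,b): |β_{2k+1,2l+1}(t)| ⪯ (det M(t)) · (1 + 3(k+l)) · m⁺(t)^{2(k+l)−1} · M⁺(t). -/
open MeasureTheory Filter Topology Matrix Set
open scoped ENNReal

noncomputable section

/-- The trace of a product of two positive semidefinite `2 × 2` matrices is nonnegative. -/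
lemma trace_mul_nonneg_of_quadForm_nonneg {p q r x y z : ℝ}
    (h : ∀ c d : ℝ, 0 ≤ p * c ^ 2 + 2 * r * c * d + q * d ^ 2)
    (h' : ∀ c d : ℝ, 0 ≤ x * c ^ 2 + 2 * z * c * d + y * d ^ 2) :
    0 ≤ p * x + q * y + 2 * r * z := by
  have hp : 0 ≤ p := by simpa using h 1 0
  have hq : 0 ≤ q := by simpa using h 0 1
  have hx : 0 ≤ x := by simpa using h' 1 0
  have hy : 0 ≤ y := by simpa using h' 0 1
  have det_nonneg : ∀ {p q r : ℝ}, 0 ≤ p →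
      (∀ c d : ℝ, 0 ≤ p * c ^ 2 + 2 * r * c * d + q * d ^ 2) → r ^ 2 ≤ p * q := by
    intro p q r _ h
    have := discrim_le_zero (a := p) (b := 2 * r) (c := q) fun c => by
      have := h c 1
      nlinarith
    unfold discrim at this
    nlinarith
  have h1 := det_nonneg hp h
  have h2 := det_nonneg hx h'
  have h3 : (2 * r * z) ^ 2 ≤ (p * x + q * y) ^ 2 := by
    have : r ^ 2 * z ^ 2 ≤ p * q * (x * y) := mul_le_mul h1 h2 (sq_nonneg _) (by positivity)
    nlinarith [sq_nonneg (p * x - q * y)]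
  have := abs_le_of_sq_le_sq h3 (by positivity)
  linarith [neg_le_of_abs_le this]

/-- If `uᵀu ≤ E • M` for a row vector `u = (U, V)`, then pairing with the adjugate of a
positive semidefinite matrix preserves the inequality. -/
lemma adjugate_pairing_le {p q r x y z U V E : ℝ}
    (h : ∀ c d : ℝ, 0 ≤ p * c ^ 2 + 2 * r * c * d + q * d ^ 2)
    (h' : ∀ c d : ℝ, (U * c + V * d) ^ 2 ≤ E * (x * c ^ 2 + 2 * z * c * d + y * d ^ 2)) :
    p * V ^ 2 - 2 * r * U * V + q * U ^ 2 ≤ E * (p * y + q * x - 2 * r * z) := by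
  have := trace_mul_nonneg_of_quadForm_nonneg (p := q) (q := p) (r := -r)
    (x := E * x - U ^ 2) (y := E * y - V ^ 2) (z := E * z - U * V)
    (fun c d => by have := h d (-c); nlinarith) (fun c d => by have := h' c d; nlinarith)
  nlinarith

section QuadraticEnergy

variable {a T : ℝ} {p q r f g : ℝ → ℝ}

lemma quadForm_intervalIntegrable (hp : IntervalIntegrable p volume a T)
    (hq : IntervalIntegrable q volume a T) (hr : IntervalIntegrable r volume a T)
    (hf : ContinuousOn f (uIcc a T)) (hg : ContinuousOn g (uIcc a T)) :
    IntervalIntegrable (fun s => p s * f s ^ 2 + 2 * r s * f s * g s + q s * g s ^ 2)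
      volume a T := by
  refine ((hp.mul_continuousOn (hf.pow 2)).add ?_).add (hq.mul_continuousOn (hg.pow 2))
  exact ((hr.const_mul 2).mul_continuousOn hf).mul_continuousOn hg

/-- Monotonicity in the upper endpoint of the integral of a nonnegative function. -/
lemma integral_mono_upper {F : ℝ → ℝ} {s : ℝ} (hs : s ∈ Icc a T)
    (hF : IntervalIntegrable F volume a T) (h0 : ∀ᵐ u, u ∈ Icc a T → 0 ≤ F u) :
    ∫ u in a..s, F u ≤ ∫ u in a..T, F u := by
  refine intervalIntegral.integral_mono_interval le_rfl hs.1 hs.2 ?_ hF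
  filter_upwards [(ae_restrict_iff' measurableSet_Ioc).2 (h0.mono fun u hu hu' =>
    hu (Ioc_subset_Icc_self hu'))] with u hu using hu

lemma integral_nonneg_of_ae_Icc {F : ℝ → ℝ} {s : ℝ} (hs : s ∈ Icc a T)
    (h0 : ∀ᵐ u, u ∈ Icc a T → 0 ≤ F u) : 0 ≤ ∫ u in a..s, F u :=
  intervalIntegral.integral_nonneg_of_ae_restrict hs.1 <|
    (ae_restrict_iff' measurableSet_Icc).2 <| h0.mono fun _ hu hu' => hu ⟨hu'.1, hu'.2.trans hs.2⟩

/-- Cauchy–Schwarz inequality for the semi-inner product with density `[[p, r], [r, q]]`. -/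
lemma sq_integral_le_energy_mul (hp : IntervalIntegrable p volume a T)
    (hq : IntervalIntegrable q volume a T) (hr : IntervalIntegrable r volume a T)
    (hpsd : ∀ᵐ s, s ∈ Icc a T → ∀ c d : ℝ, 0 ≤ p s * c ^ 2 + 2 * r s * c * d + q s * d ^ 2)
    (hf : ContinuousOn f (uIcc a T)) (hg : ContinuousOn g (uIcc a T))
    {s : ℝ} (hs : s ∈ Icc a T) (c d : ℝ) :
    ((∫ u in a..s, (f u * p u + g u * r u)) * c + (∫ u in a..s, (f u * r u + g u * q u)) * d) ^ 2
      ≤ (∫ u in a..T, (p u * f u ^ 2 + 2 * r u * f u * g u + q u * g u ^ 2)) *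
        ((∫ u in a..T, p u) * c ^ 2 + 2 * (∫ u in a..T, r u) * c * d
          + (∫ u in a..T, q u) * d ^ 2) := by
  have haT : a ≤ T := hs.1.trans hs.2
  have hsub : uIcc a s ⊆ uIcc a T := by
    rw [uIcc_of_le hs.1, uIcc_of_le haT]; exact Icc_subset_Icc_right hs.2
  have hp' := hp.mono_set hsub
  have hq' := hq.mono_set hsub
  have hr' := hr.mono_set hsub
  have hf' := hf.mono hsub
  have hg' := hg.mono hsub
  have hE := quadForm_intervalIntegrable hp hq hr hf hg
  have hE' := quadForm_intervalIntegrable hp' hq' hr' hf' hg'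
  have hU : IntervalIntegrable (fun u => f u * p u + g u * r u) volume a s :=
    (hp'.continuousOn_mul hf').add (hr'.continuousOn_mul hg')
  have hV : IntervalIntegrable (fun u => f u * r u + g u * q u) volume a s :=
    (hr'.continuousOn_mul hf').add (hq'.continuousOn_mul hg')
  have hQ : ∀ {v : ℝ}, IntervalIntegrable p volume a v → IntervalIntegrable q volume a v →
      IntervalIntegrable r volume a v →
      ∫ u in a..v, (p u * c ^ 2 + 2 * r u * c * d + q u * d ^ 2) =
        (∫ u in a..v, p u) * c ^ 2 + 2 * (∫ u in a..v, r u) * c * d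
          + (∫ u in a..v, q u) * d ^ 2 := by
    intro v hp hq hr
    rw [intervalIntegral.integral_add
        ((hp.mul_const _).add (((hr.const_mul 2).mul_const _).mul_const _)) (hq.mul_const _),
      intervalIntegral.integral_add (hp.mul_const _) (((hr.const_mul 2).mul_const _).mul_const _)]
    simp only [intervalIntegral.integral_mul_const, intervalIntegral.integral_const_mul]
  have hQi : ∀ {v : ℝ}, IntervalIntegrable p volume a v → IntervalIntegrable q volume a v →
      IntervalIntegrable r volume a v →
      IntervalIntegrable (fun u => p u * c ^ 2 + 2 * r u * c * d + q u * d ^ 2) volume a v :=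
    fun hp hq hr => quadForm_intervalIntegrable hp hq hr continuousOn_const continuousOn_const
  have hE0 : ∀ᵐ u, u ∈ Icc a T → 0 ≤ p u * f u ^ 2 + 2 * r u * f u * g u + q u * g u ^ 2 :=
    hpsd.mono fun u hu h => hu h _ _
  have hQ0 : ∀ᵐ u, u ∈ Icc a T → 0 ≤ p u * c ^ 2 + 2 * r u * c * d + q u * d ^ 2 :=
    hpsd.mono fun u hu h => hu h _ _
  rw [← hQ hp hq hr]
  refine le_trans ?_ (mul_le_mul (integral_mono_upper hs hE hE0)
    (integral_mono_upper hs (hQi hp hq hr) hQ0) (integral_nonneg_of_ae_Icc hs hQ0)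
    (integral_nonneg_of_ae_Icc ⟨haT, le_rfl⟩ hE0))
  have hdisc := discrim_le_zero
    (a := ∫ u in a..s, (p u * c ^ 2 + 2 * r u * c * d + q u * d ^ 2))
    (b := 2 * ((∫ u in a..s, (f u * p u + g u * r u)) * c
      + (∫ u in a..s, (f u * r u + g u * q u)) * d))
    (c := ∫ u in a..s, (p u * f u ^ 2 + 2 * r u * f u * g u + q u * g u ^ 2)) fun x => by
      have h0 : 0 ≤ ∫ u in a..s, (p u * (f u + x * c) ^ 2
          + 2 * r u * (f u + x * c) * (g u + x * d) + q u * (g u + x * d) ^ 2) :=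
        integral_nonneg_of_ae_Icc hs (hpsd.mono fun u hu h => hu h _ _)
      refine h0.trans_eq ?_
      have hUV := (hU.mul_const c).add (hV.mul_const d)
      have h1 := (hQi hp' hq' hr').mul_const (x * x)
      have h2 := (hUV.const_mul 2).mul_const x
      rw [← intervalIntegral.integral_mul_const c, ← intervalIntegral.integral_mul_const d,
        ← intervalIntegral.integral_add (hU.mul_const c) (hV.mul_const d),
        ← intervalIntegral.integral_const_mul, ← intervalIntegral.integral_mul_const x,
        ← intervalIntegral.integral_mul_const (x * x), ← intervalIntegral.integral_add h1 h2,
        ← intervalIntegral.integral_add (h1.add h2) hE']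
      exact intervalIntegral.integral_congr fun u _ => by ring
  unfold discrim at hdisc
  nlinarith

/-- One step of the recursion multiplies the energy at most by `2 det M`. -/
lemma energy_step_le (haT : a ≤ T) (hp : IntervalIntegrable p volume a T)
    (hq : IntervalIntegrable q volume a T) (hr : IntervalIntegrable r volume a T)
    (hpsd : ∀ᵐ s, s ∈ Icc a T → ∀ c d : ℝ, 0 ≤ p s * c ^ 2 + 2 * r s * c * d + q s * d ^ 2)
    (hf : ContinuousOn f (uIcc a T)) (hg : ContinuousOn g (uIcc a T))
    {U V : ℝ → ℝ} (hU : ContinuousOn U (uIcc a T)) (hV : ContinuousOn V (uIcc a T))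
    (hUeq : ∀ s ∈ Icc a T, U s = ∫ u in a..s, (f u * p u + g u * r u))
    (hVeq : ∀ s ∈ Icc a T, V s = ∫ u in a..s, (f u * r u + g u * q u)) :
    ∫ u in a..T, (p u * (-V u) ^ 2 + 2 * r u * (-V u) * U u + q u * U u ^ 2) ≤
      (∫ u in a..T, (p u * f u ^ 2 + 2 * r u * f u * g u + q u * g u ^ 2)) *
        (2 * ((∫ u in a..T, p u) * (∫ u in a..T, q u) - (∫ u in a..T, r u) ^ 2)) := by
  have hCS := fun s hs => sq_integral_le_energy_mul (s := s) hp hq hr hpsd hf hg hs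
  set E := ∫ u in a..T, (p u * f u ^ 2 + 2 * r u * f u * g u + q u * g u ^ 2)
  set x := ∫ u in a..T, p u with hx
  set y := ∫ u in a..T, q u with hy
  set z := ∫ u in a..T, r u with hz
  have hi : IntervalIntegrable (fun u => E * (p u * y + q u * x - 2 * r u * z)) volume a T :=
    (((hp.mul_const _).add (hq.mul_const _)).sub ((hr.const_mul 2).mul_const _)).const_mul _
  have key : E * (2 * (x * y - z ^ 2)) = ∫ u in a..T, E * (p u * y + q u * x - 2 * r u * z) := by
    rw [intervalIntegral.integral_const_mul, intervalIntegral.integral_sub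
      ((hp.mul_const _).add (hq.mul_const _)) ((hr.const_mul 2).mul_const _),
      intervalIntegral.integral_add (hp.mul_const _) (hq.mul_const _)]
    simp only [intervalIntegral.integral_mul_const, intervalIntegral.integral_const_mul]
    rw [← hx, ← hy, ← hz]
    ring
  rw [key]
  refine intervalIntegral.integral_mono_ae_restrict haT
    (quadForm_intervalIntegrable hp hq hr hV.neg hU) hi
    ((ae_restrict_iff' measurableSet_Icc).2 (hpsd.mono fun u hu hu' => ?_))
  have h := adjugate_pairing_le (hu hu') (fun c d => hCS u hu' c d)
  rw [← hUeq u hu', ← hVeq u hu'] at h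
  refine le_trans (le_of_eq ?_) h
  ring

/-- The antisymmetric pairing of two vectors dominated by the same positive semidefinite matrix. -/
lemma sq_wedge_le {x y z U V U' V' E F : ℝ} (hE : 0 ≤ E)
    (hM : ∀ c d : ℝ, 0 ≤ x * c ^ 2 + 2 * z * c * d + y * d ^ 2)
    (h : ∀ c d : ℝ, (U * c + V * d) ^ 2 ≤ E * (x * c ^ 2 + 2 * z * c * d + y * d ^ 2))
    (h' : ∀ c d : ℝ, (U' * c + V' * d) ^ 2 ≤ F * (x * c ^ 2 + 2 * z * c * d + y * d ^ 2)) :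
    (U * V' - V * U') ^ 2 ≤ 2 * E * F * (x * y - z ^ 2) := by
  have h1 := h V' (-U')
  have h2 := mul_le_mul_of_nonneg_left (adjugate_pairing_le hM h') hE
  nlinarith

end QuadraticEnergy

section CoeffSeq

variable {a T : ℝ} {H : ℝ → Matrix (Fin 2) (Fin 2) ℝ} {W : ℕ → ℝ → Matrix (Fin 2) (Fin 2) ℝ}

lemma coeffSeq_succ_zero (hW : IsCoeffSeq a H W) (n : ℕ) (i : Fin 2) (t : ℝ) :
    W (n + 1) t i 0 = -∫ s in a..t, (W n s i 0 * H s 0 1 + W n s i 1 * H s 1 1) := by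
  rw [hW.2]
  simp [Matrix.mul_apply, Fin.sum_univ_two, Jmat]

lemma coeffSeq_succ_one (hW : IsCoeffSeq a H W)
    (hsymm : ∀ᵐ s, s ∈ Icc a T → H s 1 0 = H s 0 1) (n : ℕ) (i : Fin 2) {t : ℝ}
    (ht : t ∈ Icc a T) :
    W (n + 1) t i 1 = ∫ s in a..t, (W n s i 0 * H s 0 0 + W n s i 1 * H s 0 1) := by
  rw [hW.2]
  simp only [Matrix.mul_apply, Fin.sum_univ_two, Jmat]
  simp
  refine intervalIntegral.integral_congr_ae (hsymm.mono fun s hs hs' => ?_)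
  rw [uIoc_of_le ht.1] at hs'
  rw [hs ⟨hs'.1.le, hs'.2.trans ht.2⟩]

lemma coeffSeq_continuousOn (hW : IsCoeffSeq a H W)
    (hH : ∀ i j, IntervalIntegrable (fun s => H s i j) volume a T) (n : ℕ) (i j : Fin 2) :
    ContinuousOn (fun s => W n s i j) (uIcc a T) := by
  induction n generalizing i j with
  | zero => simp only [hW.1]; exact continuousOn_const
  | succ n ih =>
    have key : ∀ l, ContinuousOn (fun t => ∫ s in a..t, (W n s * H s) i l) (uIcc a T) := by
      intro l
      refine intervalIntegral.continuousOn_primitive_interval' ?_ left_mem_uIcc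
      simp only [Matrix.mul_apply, Fin.sum_univ_two]
      exact ((hH 0 l).continuousOn_mul (ih i 0)).add ((hH 1 l).continuousOn_mul (ih i 1))
    have : (fun s => W (n + 1) s i j) = fun t => (∫ s in a..t, (W n s * H s) i 0) * (-Jmat) 0 j
        + (∫ s in a..t, (W n s * H s) i 1) * (-Jmat) 1 j := by
      funext t
      rw [hW.2, Matrix.mul_apply, Fin.sum_univ_two]
      rfl
    rw [this]
    exact ((key 0).mul continuousOn_const).add ((key 1).mul continuousOn_const)

/-- The energy `∫ w H w*` of the `i`-th row `w` of `W_n`. -/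
def rowEnergy (a T : ℝ) (H : ℝ → Matrix (Fin 2) (Fin 2) ℝ)
    (W : ℕ → ℝ → Matrix (Fin 2) (Fin 2) ℝ) (n : ℕ) (i : Fin 2) : ℝ :=
  ∫ u in a..T, (H u 0 0 * W n u i 0 ^ 2 + 2 * H u 0 1 * W n u i 0 * W n u i 1
    + H u 1 1 * W n u i 1 ^ 2)

lemma rowEnergy_le (haT : a ≤ T) (hW : IsCoeffSeq a H W)
    (hH : ∀ i j, IntervalIntegrable (fun s => H s i j) volume a T)
    (hsymm : ∀ᵐ s, s ∈ Icc a T → H s 1 0 = H s 0 1)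
    (hpsd : ∀ᵐ s, s ∈ Icc a T → ∀ c d : ℝ,
      0 ≤ H s 0 0 * c ^ 2 + 2 * H s 0 1 * c * d + H s 1 1 * d ^ 2)
    (hdet : 0 ≤ m1 a H T * m2 a H T - m3 a H T ^ 2) (n : ℕ) (i : Fin 2) :
    rowEnergy a T H W n i ≤ (∫ u in a..T, H u i i) *
      (2 * (m1 a H T * m2 a H T - m3 a H T ^ 2)) ^ n := by
  induction n with
  | zero => fin_cases i <;> simp [rowEnergy, hW.1]
  | succ n ih =>
    have hc := coeffSeq_continuousOn hW hH
    have hstep := energy_step_le haT (hH 0 0) (hH 1 1) (hH 0 1) hpsd (hc n i 0) (hc n i 1)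
      (U := fun s => W (n + 1) s i 1) (V := fun s => -W (n + 1) s i 0)
      (hc (n + 1) i 1) (hc (n + 1) i 0).neg
      (fun s hs => coeffSeq_succ_one hW hsymm n i hs)
      (fun s hs => by simp only [coeffSeq_succ_zero hW n i, neg_neg])
    simp only [neg_neg] at hstep
    refine hstep.trans ?_
    rw [pow_succ _ n, ← mul_assoc (∫ u in a..T, H u i i)]
    exact mul_le_mul_of_nonneg_right ih (mul_nonneg zero_le_two hdet)

end CoeffSeq

/-- Proposition 3.4: refined estimate for `β_{2k+1,2l+1}`. -/
theorem stmt7 (a : ℝ) (b : EReal) (H : ℝ → Matrix (Fin 2) (Fin 2) ℝ)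
    (hH : IsHamiltonian a b H)
    (W : ℕ → ℝ → Matrix (Fin 2) (Fin 2) ℝ) (hW : IsCoeffSeq a H W) :
    ∀ k l : ℕ, ¬(k = 0 ∧ l = 0) → ∀ t : ℝ, a ≤ t → (t : EReal) < b →
      entryAbsLe (betaMat W (2 * k + 1) (2 * l + 1) t)
        (((Mmat a H t).det * (1 + 3 * ((k : ℝ) + (l : ℝ))) *
            mplus a H t ^ (2 * (k + l) - 1)) • MplusMat a H t) := by
  intro k l hkl T haT hTb
  have hH' : ∀ i j, IntervalIntegrable (fun s => H s i j) volume a T :=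
    fun i j => hH.locInt i j T haT hTb
  have hps : ∀ᵐ s, s ∈ Icc a T → (H s).PosSemidef :=
    hH.posSemidef.mono fun s hs hs' =>
      hs hs'.1 (lt_of_le_of_lt (EReal.coe_le_coe_iff.2 hs'.2) hTb)
  have hsymm : ∀ᵐ s, s ∈ Icc a T → H s 1 0 = H s 0 1 :=
    hps.mono fun s hs hs' => by simpa using (hs hs').1.apply 0 1
  have hpsd : ∀ᵐ s, s ∈ Icc a T → ∀ c d : ℝ,
      0 ≤ H s 0 0 * c ^ 2 + 2 * H s 0 1 * c * d + H s 1 1 * d ^ 2 := by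
    filter_upwards [hps, hsymm] with s hs hs' hmem c d
    have h := (hs hmem).dotProduct_mulVec_nonneg ![c, d]
    simp [Matrix.mulVec, dotProduct, Fin.sum_univ_two, hs' hmem] at h
    linarith
  have hT : T ∈ Icc a T := ⟨haT, le_rfl⟩
  have hc := coeffSeq_continuousOn hW hH'
  have hm1 : 0 ≤ m1 a H T := integral_nonneg_of_ae_Icc hT
    (hpsd.mono fun u hu h => by simpa using hu h 1 0)
  have hm2 : 0 ≤ m2 a H T := integral_nonneg_of_ae_Icc hT
    (hpsd.mono fun u hu h => by simpa using hu h 0 1)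
  have hM : ∀ c d : ℝ, 0 ≤ m1 a H T * c ^ 2 + 2 * m3 a H T * c * d + m2 a H T * d ^ 2 := by
    intro c d
    have h0 := integral_nonneg_of_ae_Icc (F := fun u => H u 0 0 * c ^ 2 + 2 * H u 0 1 * c * d
      + H u 1 1 * d ^ 2) hT (hpsd.mono fun u hu h => hu h c d)
    rwa [intervalIntegral.integral_add (((hH' 0 0).mul_const _).add
        ((((hH' 0 1).const_mul 2).mul_const _).mul_const _)) ((hH' 1 1).mul_const _),
      intervalIntegral.integral_add ((hH' 0 0).mul_const _)
        ((((hH' 0 1).const_mul 2).mul_const _).mul_const _),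
      intervalIntegral.integral_mul_const, intervalIntegral.integral_mul_const,
      intervalIntegral.integral_mul_const, intervalIntegral.integral_mul_const,
      intervalIntegral.integral_const_mul] at h0
  set D := m1 a H T * m2 a H T - m3 a H T ^ 2 with hD
  have hD0 : 0 ≤ D := by
    have := discrim_le_zero (a := m1 a H T) (b := 2 * m3 a H T) (c := m2 a H T) fun c => by
      have := hM c 1
      nlinarith
    unfold discrim at this
    nlinarith
  have hdet : (Mmat a H T).det = D := by
    rw [Mmat, Matrix.det_fin_two_of, hD]; ring
  have hE0 : ∀ n i, 0 ≤ rowEnergy a T H W n i := fun n i =>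
    integral_nonneg_of_ae_Icc hT (hpsd.mono fun u hu h => hu h _ _)
  have hdiag : ∀ i, 0 ≤ ∫ u in a..T, H u i i := by
    intro i
    fin_cases i
    exacts [hm1, hm2]
  have hrow : ∀ n i, ∀ c d : ℝ, (W (n + 1) T i 1 * c + (-W (n + 1) T i 0) * d) ^ 2 ≤
      rowEnergy a T H W n i *
        (m1 a H T * c ^ 2 + 2 * m3 a H T * c * d + m2 a H T * d ^ 2) := by
    intro n i c d
    rw [coeffSeq_succ_zero hW, coeffSeq_succ_one hW hsymm n i hT, neg_neg]
    exact sq_integral_le_energy_mul (hH' 0 0) (hH' 1 1) (hH' 0 1) hpsd (hc n i 0) (hc n i 1) hT c d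
  have hplus : ∀ i j, 0 ≤ MplusMat a H T i j ∧
      MplusMat a H T i j ^ 2 = (∫ u in a..T, H u i i) * ∫ u in a..T, H u j j := by
    have hs := Real.sq_sqrt (mul_nonneg hm1 hm2)
    intro i j
    fin_cases i <;> fin_cases j
    · exact ⟨hm1, sq _⟩
    · exact ⟨Real.sqrt_nonneg _, hs⟩
    · exact ⟨Real.sqrt_nonneg _, hs.trans (mul_comm _ _)⟩
    · exact ⟨hm2, sq _⟩
  have hmp : 0 ≤ mplus a H T := mul_nonneg zero_le_two (Real.sqrt_nonneg _)
  have hDm : 4 * D ≤ mplus a H T ^ 2 := by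
    rw [mplus, mul_pow, Real.sq_sqrt (mul_nonneg hm1 hm2)]
    nlinarith [sq_nonneg (m3 a H T)]
  intro i j
  have hentry : betaMat W (2 * k + 1) (2 * l + 1) T i j =
      W (2 * k + 1) T i 1 * W (2 * l + 1) T j 0
        - W (2 * k + 1) T i 0 * W (2 * l + 1) T j 1 := by
    simp [betaMat, Matrix.mul_apply, Fin.sum_univ_two, Jmat]
    ring
  have hw := sq_wedge_le (hE0 (2 * k) i) hM (hrow (2 * k) i) (hrow (2 * l) j)
  obtain ⟨hP0, hP⟩ := hplus i j
  obtain ⟨N, hN⟩ : ∃ N, k + l = N + 1 := Nat.exists_eq_succ_of_ne_zero (by omega)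
  rw [hdet, Matrix.smul_apply, smul_eq_mul]
  have hkl' : (k : ℝ) + l = N + 1 := by exact_mod_cast hN
  rw [hkl', hN, show 2 * (N + 1) - 1 = 2 * N + 1 by omega]
  refine abs_le_of_sq_le_sq ?_ (by positivity)
  have hEE : rowEnergy a T H W (2 * k) i * rowEnergy a T H W (2 * l) j ≤
      MplusMat a H T i j ^ 2 * (2 * D) ^ (2 * N + 2) := by
    calc _ ≤ ((∫ u in a..T, H u i i) * (2 * D) ^ (2 * k)) *
          ((∫ u in a..T, H u j j) * (2 * D) ^ (2 * l)) :=
        mul_le_mul (rowEnergy_le haT hW hH' hsymm hpsd hD0 _ _)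
          (rowEnergy_le haT hW hH' hsymm hpsd hD0 _ _) (hE0 _ _)
          (mul_nonneg (hdiag i) (by positivity))
      _ = _ := by
        rw [hP, show 2 * N + 2 = 2 * k + 2 * l by omega, pow_add]; ring
  have hpow : (2 * D) ^ (2 * N + 1) ≤ (mplus a H T ^ 2) ^ (2 * N + 1) :=
    pow_le_pow_left₀ (by positivity) (by linarith) _
  calc betaMat W (2 * k + 1) (2 * l + 1) T i j ^ 2
      ≤ 2 * rowEnergy a T H W (2 * k) i * rowEnergy a T H W (2 * l) j * D := by
        refine le_trans (le_of_eq ?_) hw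
        rw [hentry]; ring
    _ ≤ 2 * (MplusMat a H T i j ^ 2 * (2 * D) ^ (2 * N + 2)) * D := by
        rw [mul_assoc 2]
        gcongr
    _ = 4 * D ^ 2 * MplusMat a H T i j ^ 2 * (2 * D) ^ (2 * N + 1) := by ring
    _ ≤ 4 * D ^ 2 * MplusMat a H T i j ^ 2 * (mplus a H T ^ 2) ^ (2 * N + 1) := by gcongr
    _ ≤ (1 + 3 * ((N : ℝ) + 1)) ^ 2 * D ^ 2 * MplusMat a H T i j ^ 2
          * (mplus a H T ^ 2) ^ (2 * N + 1) := by
        gcongr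
        nlinarith [Nat.cast_nonneg (α := ℝ) N]
    _ = _ := by ring

end
end

section
/- Let −∞ < a < b ≤ ∞ and let μ and ν be positive Borel measures on [a,b). Then ∫_{[a,b)} μ([a,t)) dν(t) = ∫_{[a,b)} ν((t,b)) dμ(t). Moreover, if these integrals are finite, then lim_{t→b} μ([a,t))·ν([t,b)) = 0. -/
open MeasureTheory Filter Topology Matrix Set
open scoped ENNReal

noncomputable section

/-- A measure restricted to a countable union of measurable sets of finite measure is
σ-finite. -/
theorem sigmaFinite_restrict_iUnion {α ι : Type*} [MeasurableSpace α] [Countable ι]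
    {μ : Measure α} {S : ι → Set α} (hS : ∀ i, MeasurableSet (S i)) (hμ : ∀ i, μ (S i) < ⊤) :
    SigmaFinite (μ.restrict (⋃ i, S i)) := by
  refine Measure.sigmaFinite_of_countable (S := insert (⋃ i, S i)ᶜ (range S))
    ((countable_range S).insert _) ?_ ?_
  · rintro s (rfl | ⟨i, rfl⟩)
    · rw [Measure.restrict_apply (MeasurableSet.iUnion hS).compl, compl_inter_self]
      simp
    · exact (Measure.restrict_apply_le _ _).trans_lt (hμ i)
  · rw [sUnion_insert, sUnion_range, compl_union_self]

/-- Tonelli's theorem for the region below the diagonal, for s-finite measures. -/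
theorem lintegral_measure_Ioi_eq_of_sFinite (μ ν : Measure ℝ) [SFinite μ] [SFinite ν] :
    ∫⁻ s, ν (Ioi s) ∂μ = ∫⁻ t, μ (Iio t) ∂ν := by
  have h : MeasurableSet {p : ℝ × ℝ | p.1 < p.2} := measurableSet_lt measurable_fst measurable_snd
  exact (Measure.prod_apply h).symm.trans (Measure.prod_apply_symm h)

theorem measurable_measure_Iio (μ : Measure ℝ) : Measurable fun t => μ (Iio t) :=
  Monotone.measurable fun _ _ h => measure_mono (Iio_subset_Iio h)

theorem lintegral_measure_Ioi_le (μ ν : Measure ℝ) :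
    ∫⁻ s, ν (Ioi s) ∂μ ≤ ∫⁻ t, μ (Iio t) ∂ν := by
  by_cases hI : ∫⁻ t, μ (Iio t) ∂ν = ⊤
  · simp [hI]
  have hfin : ∀ᵐ t ∂ν, μ (Iio t) < ⊤ := ae_lt_top (measurable_measure_Iio μ) hI
  set U : Set ℝ := ⋃ q : {q : ℚ // μ (Iio (q : ℝ)) < ⊤}, Iio ((q : ℚ) : ℝ) with hU
  set V : Set ℝ := ⋃ q : {q : ℚ // μ (Iio (q : ℝ)) ≠ 0}, Ici ((q : ℚ) : ℝ) with hV
  have : SigmaFinite (μ.restrict U) :=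
    sigmaFinite_restrict_iUnion (fun _ => measurableSet_Iio) fun q => q.2
  have : SigmaFinite (ν.restrict V) := by
    refine sigmaFinite_restrict_iUnion (fun _ => measurableSet_Ici) fun q => ?_
    refine (measure_mono (t := {t | μ (Iio ((q : ℚ) : ℝ)) ≤ μ (Iio t)}) fun t ht =>
      measure_mono (Iio_subset_Iio (mem_Ici.1 ht))).trans_lt
      (lt_top_iff_ne_top.2 fun h => hI (top_le_iff.1 ?_))
    have hm := mul_meas_ge_le_lintegral (μ := ν) (measurable_measure_Iio μ) (μ (Iio ((q : ℚ) : ℝ)))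
    rwa [h, ENNReal.mul_top q.2] at hm
  have hUm : MeasurableSet U := MeasurableSet.iUnion fun _ => measurableSet_Iio
  have hnull : ∀ᵐ s ∂μ, ∀ q : ℚ, μ (Iio (q : ℝ)) = 0 → (q : ℝ) ≤ s := by
    refine ae_all_iff.2 fun q => ?_
    by_cases hq : μ (Iio (q : ℝ)) = 0
    · filter_upwards [measure_eq_zero_iff_ae_notMem.1 hq] with s hs _
      simpa using hs
    · simp [hq]
  calc ∫⁻ s, ν (Ioi s) ∂μ
      ≤ ∫⁻ s, U.indicator (fun s => ν.restrict V (Ioi s)) s ∂μ := by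
        refine lintegral_mono_ae ?_
        filter_upwards [hnull] with s hs
        by_cases hsU : s ∈ U
        · rw [indicator_of_mem hsU, Measure.restrict_eq_self]
          intro t ht
          obtain ⟨q, hsq, hqt⟩ := exists_rat_btwn (mem_Ioi.1 ht)
          exact mem_iUnion.2 ⟨⟨q, fun h => (hs q h).not_gt hsq⟩, hqt.le⟩
        · rw [indicator_of_notMem hsU, nonpos_iff_eq_zero]
          refine measure_mono_null (fun t ht => ?_) (ae_iff.1 hfin)
          intro h
          obtain ⟨q, hsq, hqt⟩ := exists_rat_btwn (mem_Ioi.1 ht)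
          exact hsU (mem_iUnion.2
            ⟨⟨q, (measure_mono (Iio_subset_Iio hqt.le)).trans_lt h⟩, hsq⟩)
    _ = ∫⁻ s in U, ν.restrict V (Ioi s) ∂μ := lintegral_indicator hUm _
    _ = ∫⁻ t in V, μ.restrict U (Iio t) ∂ν := lintegral_measure_Ioi_eq_of_sFinite _ _
    _ ≤ ∫⁻ t, μ (Iio t) ∂ν :=
        lintegral_mono' Measure.restrict_le_self fun t => Measure.restrict_apply_le _ _

/-- The Tonelli identity for the region below the diagonal, for arbitrary Borel measures
on the line. -/
theorem lintegral_measure_Ioi_eq (μ ν : Measure ℝ) :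
    ∫⁻ s, ν (Ioi s) ∂μ = ∫⁻ t, μ (Iio t) ∂ν := by
  refine (lintegral_measure_Ioi_le μ ν).antisymm ?_
  have h := lintegral_measure_Ioi_le (ν.map (MeasurableEquiv.neg ℝ))
    (μ.map (MeasurableEquiv.neg ℝ))
  rw [lintegral_map_equiv, lintegral_map_equiv] at h
  simp only [MeasurableEquiv.map_apply] at h
  simpa using h

theorem eventually_lt_toBFilter {a : ℝ} {b : EReal} (hab : (a : EReal) < b) :
    ∀ᶠ t in toBFilter b, a < t := by
  have h : ∀ᶠ x in 𝓝[<] b, (a : EReal) < x :=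
    eventually_nhdsWithin_of_eventually_nhds (lt_mem_nhds hab)
  filter_upwards [h.comap fun t : ℝ => (t : EReal)] with t ht
  exact EReal.coe_lt_coe_iff.1 ht

/-- The integrals of an integrable function over `[t, b)` tend to `0` as `t → b⁻`. -/
theorem tendsto_setLIntegral_toBFilter {b : EReal} {ν : Measure ℝ} {f : ℝ → ℝ≥0∞} {S : Set ℝ}
    (hf : Measurable f) (hS : MeasurableSet S) (hSb : ∀ t ∈ S, (t : EReal) < b)
    (hfin : ∫⁻ t in S, f t ∂ν ≠ ⊤) :
    Tendsto (fun t => ∫⁻ s in S, (Ici t).indicator f s ∂ν) (toBFilter b) (𝓝 0) := by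
  have : (toBFilter b).IsCountablyGenerated := by unfold toBFilter; infer_instance
  rw [← lintegral_zero (μ := ν.restrict S)]
  refine tendsto_lintegral_filter_of_dominated_convergence f
    (Eventually.of_forall fun t => hf.indicator measurableSet_Ici)
    (Eventually.of_forall fun t => Eventually.of_forall (indicator_le_self _ f)) hfin ?_
  filter_upwards [ae_restrict_mem hS] with s hs
  refine tendsto_const_nhds.congr' ?_
  filter_upwards [eventually_lt_toBFilter (hSb s hs)] with t ht
  exact (indicator_of_notMem (notMem_Ici.2 ht) f).symm

/-- Lemma 4.5: measure-theoretic integration by parts. -/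
theorem stmt9 (a : ℝ) (b : EReal) (hab : (a : EReal) < b) (μ ν : Measure ℝ) :
    (∫⁻ t in {t : ℝ | a ≤ t ∧ (t : EReal) < b}, μ (Set.Ico a t) ∂ν) =
      (∫⁻ t in {t : ℝ | a ≤ t ∧ (t : EReal) < b},
        ν {s : ℝ | t < s ∧ (s : EReal) < b} ∂μ) ∧
    ((∫⁻ t in {t : ℝ | a ≤ t ∧ (t : EReal) < b}, μ (Set.Ico a t) ∂ν) < ⊤ →
      Tendsto (fun t : ℝ => μ (Set.Ico a t) * ν {s : ℝ | t ≤ s ∧ (s : EReal) < b})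
        (toBFilter b) (nhds 0)) := by
  set S : Set ℝ := {t : ℝ | a ≤ t ∧ (t : EReal) < b} with hSdef
  have hS : MeasurableSet S := by
    have : S = Ici a ∩ (fun t : ℝ => (t : EReal)) ⁻¹' Iio b := rfl
    rw [this]
    exact measurableSet_Ici.inter (measurable_coe_real_ereal measurableSet_Iio)
  have hF : ∀ t ∈ S, μ (Ico a t) = μ.restrict S (Iio t) := fun t ht => by
    rw [Measure.restrict_apply measurableSet_Iio]
    congr 1
    ext s
    exact ⟨fun h => ⟨h.2, h.1, (EReal.coe_lt_coe_iff.2 h.2).trans ht.2⟩, fun h => ⟨h.2.1, h.1⟩⟩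
  have hG : ∀ t ∈ S, ν {s : ℝ | t < s ∧ (s : EReal) < b} = ν.restrict S (Ioi t) := fun t ht => by
    rw [Measure.restrict_apply measurableSet_Ioi]
    congr 1
    ext s
    exact ⟨fun h => ⟨h.1, ht.1.trans h.1.le, h.2⟩, fun h => ⟨h.1, h.2.2⟩⟩
  refine ⟨?_, fun hfin => ?_⟩
  · rw [setLIntegral_congr_fun hS hF, setLIntegral_congr_fun hS hG]
    exact (lintegral_measure_Ioi_eq _ _).symm
  · have hmono : Monotone fun t => μ (Ico a t) := fun _ _ h =>
      measure_mono (Ico_subset_Ico_right h)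
    refine tendsto_of_tendsto_of_tendsto_of_le_of_le' tendsto_const_nhds
      (tendsto_setLIntegral_toBFilter hmono.measurable hS (fun t ht => ht.2) hfin.ne)
      (Eventually.of_forall fun t => zero_le) ?_
    filter_upwards [eventually_lt_toBFilter hab] with t ht
    have hset : {s : ℝ | t ≤ s ∧ (s : EReal) < b} = Ici t ∩ S := by
      ext s
      exact ⟨fun h => ⟨h.1, ht.le.trans h.1, h.2⟩, fun h => ⟨h.1, h.2.2⟩⟩
    rw [hset, ← Measure.restrict_apply measurableSet_Ici, lintegral_indicator measurableSet_Ici,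
      ← setLIntegral_const]
    exact setLIntegral_mono' measurableSet_Ici fun s hs => hmono hs

end
end
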